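/- arXiv:1709.02089 — 7 statements merged into one kernel-verified Lean document; each statement's English description precedes it below -/
import Mathlib

section
/- Let 0 < μ < 1 and ω > 0. Then for every real x, the improper Riemann–Liouville fractional integral of order μ of the imaginary exponential e^{iωt} converges conditionally and equals: lim_{R→∞} (1/Γ(μ)) ∫_{−R}^{x} (x − t)^{μ−1} e^{iωt} dt = ω^{−μ} e^{−iμπ/2} e^{iωx}. -/
open MeasureTheory Real Complex

lemma norm_exp_neg_mul_ofReal_le_one {r : ℂ} (hr : 0 ≤ r.re) {s : ℝ} (hs : 0 ≤ s) :
    ‖Complex.exp (-r * s)‖ ≤ 1 := by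
  rw [Complex.norm_exp, Real.exp_le_one_iff]
  simpa using mul_nonneg hr hs

/-- The first-derivative bound for the oscillatory integral of a decreasing power. -/
lemma norm_intervalIntegral_rpow_mul_exp_neg_mul_le {μ : ℝ} (hμ : μ ≤ 1) {r : ℂ}
    (hr : 0 ≤ r.re) (hr0 : r ≠ 0) {T S : ℝ} (hT : 0 < T) (hTS : T ≤ S) :
    ‖∫ s in T..S, ((s ^ (μ - 1) : ℝ) : ℂ) * Complex.exp (-r * s)‖ ≤
      2 * T ^ (μ - 1) / ‖r‖ := by
  have hpos : ∀ s ∈ Set.uIcc T S, 0 < s := fun s hs =>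
    hT.trans_le (Set.uIcc_of_le hTS ▸ hs).1
  have hdu : ∀ s ∈ Set.uIcc T S,
      HasDerivAt (fun s : ℝ => s ^ (μ - 1)) ((μ - 1) * s ^ (μ - 1 - 1)) s := fun s hs =>
    Real.hasDerivAt_rpow_const (Or.inl (hpos s hs).ne')
  have hdv : ∀ s ∈ Set.uIcc T S,
      HasDerivAt (fun s : ℝ => Complex.exp (-r * s) / -r) (Complex.exp (-r * s)) s := by
    intro s _
    have h := (((hasDerivAt_id (s : ℂ)).const_mul (-r)).cexp.div_const (-r)).comp_ofReal
    simpa [hr0] using h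
  have hcont : ContinuousOn (fun s : ℝ => (μ - 1) * s ^ (μ - 1 - 1)) (Set.uIcc T S) :=
    continuousOn_const.mul
      (continuousOn_id.rpow_const fun s hs => Or.inl (hpos s hs).ne')
  have hparts := intervalIntegral.integral_mul_deriv_eq_deriv_mul
    (fun s hs => (hdu s hs).ofReal_comp) hdv
    (Complex.continuous_ofReal.comp_continuousOn hcont).intervalIntegrable
    (Continuous.intervalIntegrable (by fun_prop) _ _)
  have hv : ∀ s : ℝ, 0 ≤ s → ‖Complex.exp (-r * s) / -r‖ ≤ 1 / ‖r‖ := fun s hs => by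
    rw [norm_div, norm_neg]
    gcongr
    exact norm_exp_neg_mul_ofReal_le_one hr hs
  have hboundary : ∀ s : ℝ, 0 < s →
      ‖((s ^ (μ - 1) : ℝ) : ℂ) * (Complex.exp (-r * s) / -r)‖ ≤ s ^ (μ - 1) * (1 / ‖r‖) := by
    intro s hs
    rw [norm_mul, Complex.norm_of_nonneg (by positivity)]
    gcongr
    exact hv s hs.le
  have hint : ‖∫ s in T..S, (((μ - 1) * s ^ (μ - 1 - 1) : ℝ) : ℂ) *
      (Complex.exp (-r * s) / -r)‖ ≤ (T ^ (μ - 1) - S ^ (μ - 1)) * (1 / ‖r‖) := by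
    have hFTC := intervalIntegral.integral_eq_sub_of_hasDerivAt hdu hcont.intervalIntegrable
    calc _ ≤ ∫ s in T..S, -((μ - 1) * s ^ (μ - 1 - 1)) * (1 / ‖r‖) := by
          refine intervalIntegral.norm_integral_le_of_norm_le hTS
            (Filter.Eventually.of_forall fun s hs => ?_)
            (hcont.neg.mul continuousOn_const).intervalIntegrable
          have hs0 : 0 < s := hT.trans hs.1
          rw [norm_mul, Complex.norm_real, Real.norm_of_nonpos
            (mul_nonpos_of_nonpos_of_nonneg (by linarith) (by positivity))]
          refine mul_le_mul_of_nonneg_left (hv s hs0.le) (neg_nonneg.2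
            (mul_nonpos_of_nonpos_of_nonneg (by linarith) (by positivity)))
      _ = _ := by
          rw [intervalIntegral.integral_mul_const, intervalIntegral.integral_neg, hFTC]
          ring
  rw [hparts]
  calc _ ≤ _ := (norm_sub_le _ _).trans (add_le_add (norm_sub_le _ _) le_rfl)
    _ ≤ _ := add_le_add (add_le_add (hboundary S (hT.trans_le hTS)) (hboundary T hT)) hint
    _ = _ := by ring

lemma integrableOn_ofReal_rpow_mul_exp_neg_mul {p : ℝ} (hp : -1 < p) {r : ℂ}
    (hr : 0 < r.re) :
    IntegrableOn (fun s : ℝ => ((s ^ p : ℝ) : ℂ) * Complex.exp (-r * s)) (Set.Ioi 0) := by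
  refine (integrableOn_rpow_mul_exp_neg_mul_rpow hp one_pos hr).mono'
    (Measurable.aestronglyMeasurable (by fun_prop))
    ((ae_restrict_mem measurableSet_Ioi).mono fun s hs => ?_)
  rw [norm_mul, Complex.norm_of_nonneg (rpow_nonneg (le_of_lt hs) _), Complex.norm_exp]
  simp

lemma differentiableOn_integral_rpow_mul_exp_neg_mul {p : ℝ} (hp : -1 < p) :
    DifferentiableOn ℂ
      (fun r : ℂ => ∫ s in Set.Ioi (0 : ℝ), ((s ^ p : ℝ) : ℂ) * Complex.exp (-r * s))
      {r : ℂ | 0 < r.re} := by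
  intro r (hr : 0 < r.re)
  have hopen : IsOpen {z : ℂ | r.re / 2 < z.re} := isOpen_lt continuous_const continuous_re
  refine ((hasDerivAt_integral_of_dominated_loc_of_deriv_le
    (μ := volume.restrict (Set.Ioi (0 : ℝ)))
    (F := fun (z : ℂ) (s : ℝ) => ((s ^ p : ℝ) : ℂ) * Complex.exp (-z * s))
    (F' := fun (z : ℂ) (s : ℝ) => ((s ^ p : ℝ) : ℂ) * (Complex.exp (-z * s) * -s))
    (bound := fun s => s ^ (p + 1) * Real.exp (-(r.re / 2) * s ^ (1 : ℝ)))
    (hopen.mem_nhds (half_lt_self hr))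
    (Filter.Eventually.of_forall fun z => Measurable.aestronglyMeasurable (by fun_prop))
    (integrableOn_ofReal_rpow_mul_exp_neg_mul hp hr)
    (Measurable.aestronglyMeasurable (by fun_prop)) ?_
    (integrableOn_rpow_mul_exp_neg_mul_rpow (by linarith) one_pos (half_pos hr))
    ?_).2).differentiableAt.differentiableWithinAt
  · filter_upwards [ae_restrict_mem measurableSet_Ioi] with s (hs : 0 < s) z hz
    rw [norm_mul, norm_mul, Complex.norm_of_nonneg (rpow_nonneg hs.le _), Complex.norm_exp,
      norm_neg, Complex.norm_of_nonneg hs.le, rpow_add_one hs.ne', rpow_one, mul_assoc,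
      mul_comm s]
    have h : (-z * s).re ≤ -(r.re / 2) * s := by
      simpa using mul_le_mul_of_nonneg_right (le_of_lt hz) hs.le
    gcongr
  · refine Filter.Eventually.of_forall fun s z _ => ?_
    simpa using! ((((hasDerivAt_id z).neg.mul_const (s : ℂ)).cexp).const_mul
      ((s ^ p : ℝ) : ℂ))

/-- The Laplace transform of a power at complex frequency; compare
`Complex.integral_cpow_mul_exp_neg_mul_Ioi`, where the frequency is real. -/
lemma integral_ofReal_rpow_mul_exp_neg_mul_Ioi {μ : ℝ} (hμ : 0 < μ) {r : ℂ} (hr : 0 < r.re) :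
    ∫ s in Set.Ioi (0 : ℝ), ((s ^ (μ - 1) : ℝ) : ℂ) * Complex.exp (-r * s) =
      (1 / r) ^ (μ : ℂ) * Complex.Gamma μ := by
  have hopen : IsOpen {z : ℂ | 0 < z.re} := isOpen_lt continuous_const continuous_re
  have hR : DifferentiableOn ℂ (fun r : ℂ => (1 / r) ^ (μ : ℂ) * Complex.Gamma μ)
      {z : ℂ | 0 < z.re} := by
    intro z (hz : 0 < z.re)
    have hz0 : z ≠ 0 := by rintro rfl; simp at hz
    have hslit : 1 / z ∈ slitPlane := by
      refine Or.inl ?_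
      rw [one_div, Complex.inv_re]
      exact div_pos hz (normSq_pos.2 hz0)
    exact ((((differentiableAt_const _).div differentiableAt_id hz0).cpow_const
      hslit).mul_const _).differentiableWithinAt
  refine ((differentiableOn_integral_rpow_mul_exp_neg_mul (by linarith)).analyticOnNhd
    hopen).eqOn_of_preconnected_of_frequently_eq (hR.analyticOnNhd hopen)
    (convex_halfSpace_re_gt 0).isPreconnected (z₀ := 1) (by simp) ?_ hr
  have htend : Filter.Tendsto (fun t : ℝ => (t : ℂ)) (nhdsWithin 1 (Set.Ioi 1))
      (nhdsWithin 1 {1}ᶜ) := by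
    refine tendsto_nhdsWithin_iff.2 ⟨?_, ?_⟩
    · simpa using (Complex.continuous_ofReal.tendsto 1).mono_left nhdsWithin_le_nhds
    · filter_upwards [self_mem_nhdsWithin] with t ht
      simpa using ne_of_gt ht
  refine htend.frequently (Filter.Eventually.frequently ?_)
  filter_upwards [self_mem_nhdsWithin] with t (ht : 1 < t)
  rw [← Complex.integral_cpow_mul_exp_neg_mul_Ioi (by simpa using hμ) (one_pos.trans ht)]
  refine setIntegral_congr_fun measurableSet_Ioi fun s hs => ?_
  simp [Complex.ofReal_cpow (le_of_lt hs)]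

lemma norm_intervalIntegral_rpow_mul_exp_neg_mul_sub_le {μ : ℝ} (hμ0 : 0 < μ) (hμ1 : μ ≤ 1)
    {r : ℂ} (hr : 0 < r.re) {T : ℝ} (hT : 0 < T) :
    ‖(∫ s in (0 : ℝ)..T, ((s ^ (μ - 1) : ℝ) : ℂ) * Complex.exp (-r * s)) -
      (1 / r) ^ (μ : ℂ) * Complex.Gamma μ‖ ≤ 2 * T ^ (μ - 1) / ‖r‖ := by
  have hr0 : r ≠ 0 := by rintro rfl; simp at hr
  set f : ℝ → ℂ := fun s => ((s ^ (μ - 1) : ℝ) : ℂ) * Complex.exp (-r * s)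
  have hint : IntegrableOn f (Set.Ioi 0) :=
    integrableOn_ofReal_rpow_mul_exp_neg_mul (by linarith) hr
  rw [← integral_ofReal_rpow_mul_exp_neg_mul_Ioi hμ0 hr]
  have htend := (tendsto_const_nhds (x := ∫ s in (0 : ℝ)..T, f s)).sub
    (intervalIntegral_tendsto_integral_Ioi 0 hint Filter.tendsto_id)
  refine le_of_tendsto htend.norm ((Filter.eventually_ge_atTop T).mono fun S hS => ?_)
  have hii : ∀ {b : ℝ}, 0 ≤ b → IntervalIntegrable f volume 0 b := fun hb =>
    (intervalIntegrable_iff_integrableOn_Ioc_of_le hb).2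
      (hint.mono_set Set.Ioc_subset_Ioi_self)
  rw [norm_sub_rev, id,
    intervalIntegral.integral_interval_sub_left (hii (hT.le.trans hS)) (hii hT.le)]
  exact norm_intervalIntegral_rpow_mul_exp_neg_mul_le hμ1 hr.le hr0 hT hS

/-- The Laplace transform of a power, continued to the imaginary axis with a tail bound. -/
lemma norm_intervalIntegral_rpow_mul_exp_neg_mul_I_sub_le {μ ω : ℝ} (hμ0 : 0 < μ)
    (hμ1 : μ ≤ 1) (hω : 0 < ω) {T : ℝ} (hT : 0 < T) :
    ‖(∫ s in (0 : ℝ)..T, ((s ^ (μ - 1) : ℝ) : ℂ) * Complex.exp (-(I * ω) * s)) -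
      (1 / (I * ω)) ^ (μ : ℂ) * Complex.Gamma μ‖ ≤ 2 * T ^ (μ - 1) / ‖I * (ω : ℂ)‖ := by
  have hr : Filter.Tendsto (fun ε : ℝ => (ε : ℂ) + I * ω) (nhdsWithin 0 (Set.Ioi 0))
      (nhds (I * ω)) := by
    have h : Continuous fun ε : ℝ => (ε : ℂ) + I * ω := by fun_prop
    simpa using (h.tendsto 0).mono_left nhdsWithin_le_nhds
  have hω0 : I * (ω : ℂ) ≠ 0 := by simp [hω.ne']
  have hslit : 1 / (I * (ω : ℂ)) ∈ slitPlane := by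
    refine Or.inr ?_
    simp [Complex.inv_im, hω.ne']
  have hpow := ((tendsto_const_nhds (x := (1 : ℂ))).div hr hω0).cpow
    (tendsto_const_nhds (x := (μ : ℂ))) hslit
  have hdom : Filter.Tendsto (fun ε : ℝ => ∫ s in (0 : ℝ)..T,
      ((s ^ (μ - 1) : ℝ) : ℂ) * Complex.exp (-((ε : ℂ) + I * ω) * s))
      (nhdsWithin 0 (Set.Ioi 0)) (nhds (∫ s in (0 : ℝ)..T,
        ((s ^ (μ - 1) : ℝ) : ℂ) * Complex.exp (-(I * ω) * s))) := by
    refine intervalIntegral.tendsto_integral_filter_of_dominated_convergence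
      (fun s => s ^ (μ - 1)) ?_ ?_
      (intervalIntegral.intervalIntegrable_rpow' (by linarith)) ?_
    · refine Filter.Eventually.of_forall fun ε => Measurable.aestronglyMeasurable ?_
      fun_prop
    · filter_upwards [self_mem_nhdsWithin] with ε hε
      refine Filter.Eventually.of_forall fun s hs => ?_
      have hs0 : 0 < s := (Set.uIoc_of_le hT.le ▸ hs).1
      rw [norm_mul, Complex.norm_of_nonneg (by positivity)]
      refine mul_le_of_le_one_right (by positivity)
        (norm_exp_neg_mul_ofReal_le_one ?_ hs0.le)
      simpa using le_of_lt hε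
    · exact Filter.Eventually.of_forall fun s _ =>
        ((hr.neg.mul_const _).cexp).const_mul _
  refine le_of_tendsto_of_tendsto (hdom.sub (hpow.mul_const _)).norm
    (tendsto_const_nhds.div hr.norm (norm_ne_zero_iff.2 hω0)) ?_
  filter_upwards [self_mem_nhdsWithin] with ε hε
  exact norm_intervalIntegral_rpow_mul_exp_neg_mul_sub_le hμ0 hμ1 (by simpa using hε) hT

lemma one_div_I_mul_ofReal_cpow (μ : ℝ) {ω : ℝ} (hω : 0 < ω) :
    (1 / (I * (ω : ℂ))) ^ (μ : ℂ) =
      ((ω ^ (-μ) : ℝ) : ℂ) * Complex.exp (-I * μ * π / 2) := by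
  have h : 1 / (I * (ω : ℂ)) = ((ω⁻¹ : ℝ) : ℂ) * (-I) := by
    simp [mul_comm]
  have hlog : Complex.log (1 / (I * (ω : ℂ))) = ((-Real.log ω : ℝ) : ℂ) + -(π / 2) * I := by
    rw [h, Complex.log_ofReal_mul (inv_pos.2 hω) (neg_ne_zero.2 I_ne_zero), Complex.log_neg_I,
      Real.log_inv]
  rw [cpow_def_of_ne_zero (by simp [hω.ne']), hlog, rpow_def_of_pos hω, Complex.ofReal_exp,
    ← Complex.exp_add]
  push_cast
  ring_nf

theorem tendsto_intervalIntegral_rpow_mul_exp_neg_mul_I {μ ω : ℝ} (hμ0 : 0 < μ)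
    (hμ1 : μ < 1) (hω : 0 < ω) :
    Filter.Tendsto (fun T : ℝ => ∫ s in (0 : ℝ)..T,
      ((s ^ (μ - 1) : ℝ) : ℂ) * Complex.exp (-(I * ω) * s)) Filter.atTop
      (nhds ((1 / (I * ω)) ^ (μ : ℂ) * Complex.Gamma μ)) := by
  rw [tendsto_iff_norm_sub_tendsto_zero]
  have hpow : Filter.Tendsto (fun T : ℝ => T ^ (μ - 1)) Filter.atTop (nhds 0) := by
    simpa using tendsto_rpow_neg_atTop (sub_pos.2 hμ1)
  have hbound := (hpow.const_mul 2).div_const ‖I * (ω : ℂ)‖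
  rw [mul_zero, zero_div] at hbound
  exact squeeze_zero' (Filter.Eventually.of_forall fun _ => norm_nonneg _)
    ((Filter.eventually_gt_atTop 0).mono fun T hT =>
      norm_intervalIntegral_rpow_mul_exp_neg_mul_I_sub_le hμ0 hμ1.le hω hT) hbound

/-- The (conditionally convergent) Riemann–Liouville fractional integral of order
`μ ∈ (0,1)` of `e^{iωt}` over `(-∞, x]`: the truncated integrals over `[-R, x]`
converge, as `R → ∞`, to `ω^{-μ} e^{-iμπ/2} e^{iωx}`. -/
theorem fracIntegral_exp_imaginary (μ ω : ℝ) (hμ0 : 0 < μ) (hμ1 : μ < 1) (hω : 0 < ω)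
    (x : ℝ) :
    Filter.Tendsto
      (fun R : ℝ => ((1 / Real.Gamma μ : ℝ) : ℂ) *
        ∫ t in (-R)..x, (((x - t) ^ (μ - 1) : ℝ) : ℂ) *
          Complex.exp (Complex.I * ω * t))
      Filter.atTop
      (nhds (((ω ^ (-μ) : ℝ) : ℂ) * Complex.exp (-Complex.I * μ * Real.pi / 2) *
        Complex.exp (Complex.I * ω * x))) := by
  have hΓ : (Real.Gamma μ : ℂ) ≠ 0 := ofReal_ne_zero.2 (Real.Gamma_pos_of_pos hμ0).ne'
  have hlim := (((tendsto_intervalIntegral_rpow_mul_exp_neg_mul_I hμ0 hμ1 hω).comp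
    (Filter.tendsto_atTop_add_const_left _ x Filter.tendsto_id)).const_mul
      (Complex.exp (I * ω * x))).const_mul ((1 / Real.Gamma μ : ℝ) : ℂ)
  rw [one_div_I_mul_ofReal_cpow μ hω, Complex.Gamma_ofReal] at hlim
  convert hlim using 2
  · rename_i R
    congr 1
    have hsub := intervalIntegral.integral_comp_sub_left (a := -R) (b := x)
      (fun s : ℝ => ((s ^ (μ - 1) : ℝ) : ℂ) * Complex.exp (I * ω * (x - s : ℝ))) x
    simp only [sub_sub_cancel, sub_self, sub_neg_eq_add] at hsub
    rw [hsub, Function.comp_apply, id, ← intervalIntegral.integral_const_mul]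
    refine intervalIntegral.integral_congr fun s _ => ?_
    simp only [ofReal_sub]
    rw [mul_left_comm, ← Complex.exp_add]
    ring_nf
  · push_cast
    field_simp
end

section
/- For every real x, the sine transform representation of Dawson's integral holds: (1/2) ∫_0^∞ e^{−t²/4} sin(x t) dt = e^{−x²} ∫_0^x e^{u²} du. -/
open MeasureTheory Real

lemma integrableOn_exp_neg_sq_div_four_mul_sin (x : ℝ) :
    IntegrableOn (fun t : ℝ => Real.exp (-t ^ 2 / 4) * Real.sin (x * t)) (Set.Ioi 0) := by
  have h : Integrable (fun t : ℝ => Real.exp (-t ^ 2 / 4)) := by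
    refine (integrable_exp_neg_mul_sq (b := 1 / 4) (by norm_num)).congr (.of_forall fun t => ?_)
    ring_nf
  refine h.integrableOn.mono' (by fun_prop) (.of_forall fun t => ?_)
  rw [norm_mul, Real.norm_eq_abs, Real.abs_exp, Real.norm_eq_abs]
  exact mul_le_of_le_one_right (Real.exp_pos _).le (Real.abs_sin_le_one _)

lemma integrable_abs_mul_exp_neg_sq_div_four :
    Integrable (fun t : ℝ => |t| * Real.exp (-t ^ 2 / 4)) := by
  refine (integrable_mul_exp_neg_mul_sq (b := 1 / 4) (by norm_num)).norm.congr
    (.of_forall fun t => ?_)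
  simp only [norm_mul, Real.norm_eq_abs, Real.abs_exp]
  ring_nf

lemma norm_mul_exp_neg_sq_div_four_mul_cos_le (x t : ℝ) :
    ‖t * Real.exp (-t ^ 2 / 4) * Real.cos (x * t)‖ ≤ |t| * Real.exp (-t ^ 2 / 4) := by
  rw [norm_mul, norm_mul, Real.norm_eq_abs, Real.norm_eq_abs, Real.abs_exp, Real.norm_eq_abs]
  exact mul_le_of_le_one_right (by positivity) (Real.abs_cos_le_one _)

lemma integrableOn_mul_exp_neg_sq_div_four_mul_cos (x : ℝ) :
    IntegrableOn (fun t : ℝ => t * Real.exp (-t ^ 2 / 4) * Real.cos (x * t)) (Set.Ioi 0) :=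
  integrable_abs_mul_exp_neg_sq_div_four.integrableOn.mono' (by fun_prop)
    (.of_forall (norm_mul_exp_neg_sq_div_four_mul_cos_le x))

lemma hasDerivAt_integral_exp_neg_sq_div_four_mul_sin (x : ℝ) :
    HasDerivAt (fun y : ℝ => ∫ t in Set.Ioi (0:ℝ), Real.exp (-t ^ 2 / 4) * Real.sin (y * t))
      (∫ t in Set.Ioi (0:ℝ), t * Real.exp (-t ^ 2 / 4) * Real.cos (x * t)) x := by
  refine (hasDerivAt_integral_of_dominated_loc_of_deriv_le
    (F' := fun y t => t * Real.exp (-t ^ 2 / 4) * Real.cos (y * t)) Filter.univ_mem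
    (.of_forall fun y => (integrableOn_exp_neg_sq_div_four_mul_sin y).aestronglyMeasurable)
    (integrableOn_exp_neg_sq_div_four_mul_sin x)
    (integrableOn_mul_exp_neg_sq_div_four_mul_cos x).aestronglyMeasurable
    (.of_forall fun t y _ => norm_mul_exp_neg_sq_div_four_mul_cos_le y t)
    integrable_abs_mul_exp_neg_sq_div_four.integrableOn
    (.of_forall fun t y _ => ?_)).2
  refine ((((hasDerivAt_id y).mul_const t).sin).const_mul
    (Real.exp (-t ^ 2 / 4))).congr_deriv ?_
  simp only [id]
  ring

lemma integral_mul_exp_neg_sq_div_four_mul_cos (x : ℝ) :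
    ∫ t in Set.Ioi (0:ℝ), t * Real.exp (-t ^ 2 / 4) * Real.cos (x * t) =
      2 - 2 * x * ∫ t in Set.Ioi (0:ℝ), Real.exp (-t ^ 2 / 4) * Real.sin (x * t) := by
  have hd (t : ℝ) : HasDerivAt (fun t : ℝ => -2 * (Real.exp (-t ^ 2 / 4) * Real.cos (x * t)))
      (t * Real.exp (-t ^ 2 / 4) * Real.cos (x * t) +
        2 * x * (Real.exp (-t ^ 2 / 4) * Real.sin (x * t))) t := by
    refine (((((hasDerivAt_id t).pow 2).neg.div_const 4).exp.mul
      ((hasDerivAt_id t).const_mul x).cos).const_mul (-2)).congr_deriv ?_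
    simp
    ring
  have hlim : Filter.Tendsto (fun t : ℝ => -2 * (Real.exp (-t ^ 2 / 4) * Real.cos (x * t)))
      Filter.atTop (nhds 0) := by
    have hexp : Filter.Tendsto (fun t : ℝ => Real.exp (-t ^ 2 / 4)) Filter.atTop (nhds 0) := by
      refine Real.tendsto_exp_atBot.comp ?_
      exact (Filter.tendsto_neg_atTop_atBot.comp
        (Filter.tendsto_pow_atTop two_ne_zero)).atBot_div_const (by norm_num)
    have := (hexp.zero_mul_isBoundedUnder_le (g := fun t : ℝ => Real.cos (x * t))
      (Filter.isBoundedUnder_of ⟨1, fun t => Real.abs_cos_le_one _⟩)).const_mul (-2)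
    simpa using this
  have hs := (integrableOn_exp_neg_sq_div_four_mul_sin x).const_mul (2 * x)
  have hc := integrableOn_mul_exp_neg_sq_div_four_mul_cos x
  have h := integral_Ioi_of_hasDerivAt_of_tendsto' (a := 0) (fun t _ => hd t) (hc.add hs) hlim
  rw [integral_add hc hs, integral_const_mul] at h
  norm_num at h
  linarith

/-- The sine-transform representation of Dawson's integral:
`(1/2) ∫_0^∞ e^{-t²/4} sin(xt) dt = e^{-x²} ∫_0^x e^{u²} du`. -/
theorem dawson_sine_transform (x : ℝ) :
    (1 / 2) * ∫ t in Set.Ioi (0:ℝ), Real.exp (-t ^ 2 / 4) * Real.sin (x * t) =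
      Real.exp (-x ^ 2) * ∫ u in (0:ℝ)..x, Real.exp (u ^ 2) := by
  have hd (y : ℝ) : HasDerivAt (fun y : ℝ => Real.exp (y ^ 2) *
      ((1 / 2) * ∫ t in Set.Ioi (0:ℝ), Real.exp (-t ^ 2 / 4) * Real.sin (y * t)))
      (Real.exp (y ^ 2)) y := by
    refine (((hasDerivAt_id y).pow 2).exp.mul
      ((hasDerivAt_integral_exp_neg_sq_div_four_mul_sin y).const_mul (1 / 2))).congr_deriv ?_
    rw [integral_mul_exp_neg_sq_div_four_mul_cos]
    simp
    ring
  rw [intervalIntegral.integral_eq_sub_of_hasDerivAt (fun y _ => hd y)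
    (Continuous.intervalIntegrable (by fun_prop) _ _)]
  simp only [zero_mul, Real.sin_zero, mul_zero, integral_zero, sub_zero]
  rw [← mul_assoc, ← Real.exp_add, neg_add_cancel, Real.exp_zero, one_mul]
end

section
/- For every real t, the function g(t) = e^{−t²} + i (2/√π) F(t) admits the everywhere absolutely convergent power series expansion g(t) = Σ_{n=0}^∞ (i^n / Γ((n+2)/2)) t^n. -/
open MeasureTheory Real

/-- Dawson's integral `F(x) = (1/2) ∫_0^∞ e^{-t²/4} sin(xt) dt`. -/
noncomputable def dawson (x : ℝ) : ℝ :=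
  (1 / 2) * ∫ t in Set.Ioi (0:ℝ), Real.exp (-t ^ 2 / 4) * Real.sin (x * t)

open scoped Nat

lemma four_pow_mul_factorial_sq_le (k : ℕ) : 4 ^ k * k ! * k ! ≤ (2 * k + 1)! := by
  induction k with
  | zero => simp
  | succ k ih =>
    rw [show 2 * (k + 1) + 1 = (2 * k + 1) + 1 + 1 by ring, Nat.factorial_succ (2 * k + 1 + 1),
      Nat.factorial_succ (2 * k + 1), Nat.factorial_succ k]
    calc 4 ^ (k + 1) * ((k + 1) * k !) * ((k + 1) * k !)
        = (2 * k + 2) * ((2 * k + 2) * (4 ^ k * k ! * k !)) := by ring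
      _ ≤ (2 * k + 1 + 1 + 1) * ((2 * k + 1 + 1) * (2 * k + 1)!) := by
        gcongr ?_ * (?_ * ?_) <;> omega

lemma integral_Ioi_exp_neg_sq_div_four_mul_odd_pow (k : ℕ) :
    ∫ s in Set.Ioi (0 : ℝ), Real.exp (-s ^ 2 / 4) * s ^ (2 * k + 1) = 2 * 4 ^ k * k ! := by
  have h := integral_rpow_mul_exp_neg_mul_rpow (p := 2) (q := ((2 * k + 1 : ℕ) : ℝ)) (b := 1 / 4)
    two_pos (by linarith [Nat.cast_nonneg (α := ℝ) (2 * k + 1)]) (by norm_num)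
  have hq : (((2 * k + 1 : ℕ) : ℝ) + 1) / 2 = ((k + 1 : ℕ) : ℝ) := by push_cast; ring
  rw [neg_div, hq, Real.rpow_neg (by norm_num), Real.rpow_natCast, Nat.cast_succ k,
    Real.Gamma_nat_eq_factorial] at h
  have hcongr : ∀ s : ℝ, Real.exp (-s ^ 2 / 4) * s ^ (2 * k + 1) =
      s ^ ((2 * k + 1 : ℕ) : ℝ) * Real.exp (-(1 / 4) * s ^ (2 : ℝ)) := fun s => by
    rw [Real.rpow_natCast, Real.rpow_two, mul_comm]
    congr 2
    ring
  simp_rw [hcongr]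
  rw [h, one_div, inv_pow, inv_inv]
  ring

lemma integrableOn_Ioi_exp_neg_sq_div_four_mul_pow (n : ℕ) :
    IntegrableOn (fun s : ℝ => Real.exp (-s ^ 2 / 4) * s ^ n) (Set.Ioi 0) := by
  refine (integrableOn_rpow_mul_exp_neg_mul_sq (b := 1 / 4) (s := n) (by norm_num)
    (by linarith [Nat.cast_nonneg (α := ℝ) n])).congr_fun (fun s _ => ?_) measurableSet_Ioi
  simp only [Real.rpow_natCast]
  rw [mul_comm]
  congr 2
  ring

lemma summable_four_pow_mul_factorial_div (x : ℝ) :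
    Summable fun k : ℕ => |x| ^ (2 * k + 1) / (2 * k + 1)! * (2 * 4 ^ k * k !) := by
  refine Summable.of_nonneg_of_le (fun k => by positivity) (fun k => ?_)
    ((Real.summable_pow_div_factorial (x ^ 2)).mul_left (2 * |x|))
  have h : (4 : ℝ) ^ k * k ! * k ! ≤ (2 * k + 1)! := mod_cast four_pow_mul_factorial_sq_le k
  rw [pow_succ, pow_mul, sq_abs, ← mul_div_assoc, div_mul_eq_mul_div,
    div_le_div_iff₀ (by positivity) (by positivity)]
  calc (x ^ 2) ^ k * |x| * (2 * 4 ^ k * k !) * k !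
      = 2 * |x| * (x ^ 2) ^ k * (4 ^ k * k ! * k !) := by ring
    _ ≤ _ := by gcongr

lemma hasSum_dawson (x : ℝ) :
    HasSum (fun k : ℕ => (-1) ^ k * x ^ (2 * k + 1) / (2 * k + 1)! * (4 ^ k * k !)) (dawson x) := by
  have heq (c : ℝ) (k : ℕ) (s : ℝ) : Real.exp (-s ^ 2 / 4) * (c * (x * s) ^ (2 * k + 1) /
      (2 * k + 1)!) = c * x ^ (2 * k + 1) / (2 * k + 1)! *
        (Real.exp (-s ^ 2 / 4) * s ^ (2 * k + 1)) := by
    rw [mul_pow]; ring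
  have h := hasSum_integral_of_summable_integral_norm (μ := volume.restrict (Set.Ioi (0 : ℝ)))
    (F := fun (k : ℕ) s => Real.exp (-s ^ 2 / 4) *
      ((-1) ^ k * (x * s) ^ (2 * k + 1) / (2 * k + 1)!)) (fun k => ?_) ?_
  · have hsum (s : ℝ) : ∑' k : ℕ, Real.exp (-s ^ 2 / 4) *
        ((-1) ^ k * (x * s) ^ (2 * k + 1) / (2 * k + 1)!) =
          Real.exp (-s ^ 2 / 4) * Real.sin (x * s) :=
      ((Real.hasSum_sin (x * s)).mul_left _).tsum_eq
    simp only [hsum] at h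
    simp only [heq, integral_const_mul,
      integral_Ioi_exp_neg_sq_div_four_mul_odd_pow] at h
    exact (h.mul_left (1 / 2)).congr_fun fun k => by ring
  · simp only [heq]
    exact (integrableOn_Ioi_exp_neg_sq_div_four_mul_pow _).const_mul _
  · refine (summable_four_pow_mul_factorial_div x).congr fun k => ?_
    rw [← integral_Ioi_exp_neg_sq_div_four_mul_odd_pow, ← integral_const_mul]
    refine setIntegral_congr_fun measurableSet_Ioi fun s hs => ?_
    have hs : 0 < s := hs
    simp only [heq, norm_mul, norm_div, norm_pow, norm_neg, norm_one, one_pow, one_mul,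
      Real.norm_eq_abs, abs_of_pos hs, Real.abs_exp, Nat.abs_cast]

lemma inv_Gamma_nat_add_three_halves (k : ℕ) :
    (Real.Gamma ((k : ℝ) + 3 / 2))⁻¹ = 2 / √π * (4 ^ k * k ! / (2 * k + 1)!) := by
  have h := Real.Gamma_mul_Gamma_add_half ((k : ℝ) + 1)
  rw [show (k : ℝ) + 1 + 1 / 2 = k + 3 / 2 by ring,
    show 2 * ((k : ℝ) + 1) = ((2 * k + 1 : ℕ) : ℝ) + 1 by push_cast; ring,
    Real.Gamma_nat_eq_factorial, Real.Gamma_nat_eq_factorial,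
    show (1 : ℝ) - (((2 * k + 1 : ℕ) : ℝ) + 1) = -((2 * k + 1 : ℕ) : ℝ) by ring,
    Real.rpow_neg two_pos.le, Real.rpow_natCast, pow_succ, pow_mul] at h
  norm_num at h
  have hG : 0 < Real.Gamma ((k : ℝ) + 3 / 2) := Real.Gamma_pos_of_pos (by positivity)
  have hπ : 0 < √π := Real.sqrt_pos.2 Real.pi_pos
  field_simp at h ⊢
  linarith

/-- The function `g(t) = e^{-t²} + i (2/√π) F(t)` has the everywhere absolutely
convergent power-series expansion `g(t) = Σ_{n≥0} iⁿ / Γ((n+2)/2) · tⁿ`. -/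
theorem g_taylor_series (t : ℝ) :
    (Summable fun n : ℕ =>
      ‖(Complex.I ^ n / ((Real.Gamma (((n : ℝ) + 2) / 2) : ℝ) : ℂ)) * (t : ℂ) ^ n‖) ∧
    HasSum
      (fun n : ℕ => (Complex.I ^ n / ((Real.Gamma (((n : ℝ) + 2) / 2) : ℝ) : ℂ)) * (t : ℂ) ^ n)
      (((Real.exp (-t ^ 2) : ℝ) : ℂ) +
        Complex.I * (((2 / Real.sqrt Real.pi) * dawson t : ℝ) : ℂ)) := by
  refine (fun h => ⟨h.summable.norm, h⟩) (HasSum.even_add_odd ?_ ?_)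
  · have h : HasSum (fun k : ℕ => (-t ^ 2) ^ k / k !) (Real.exp (-t ^ 2)) := by
      rw [Real.exp_eq_exp_ℝ]
      exact NormedSpace.expSeries_div_hasSum_exp _
    refine (Complex.hasSum_ofReal.2 h).congr_fun fun k => ?_
    rw [show (((2 * k : ℕ) : ℝ) + 2) / 2 = k + 1 by push_cast; ring,
      Real.Gamma_nat_eq_factorial, pow_mul, pow_mul, Complex.I_sq, neg_pow (t ^ 2)]
    push_cast
    ring
  · refine ((Complex.hasSum_ofReal.2 ((hasSum_dawson t).mul_left (2 / √π))).mul_left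
      Complex.I).congr_fun fun k => ?_
    rw [show (((2 * k + 1 : ℕ) : ℝ) + 2) / 2 = k + 3 / 2 by push_cast; ring, div_eq_mul_inv,
      ← Complex.ofReal_inv, inv_Gamma_nat_add_three_halves, pow_succ, pow_mul, Complex.I_sq]
    push_cast
    ring
end

section
/- Let γ > 0 and γ' > 0 be real numbers and set g(t) = e^{−t²} + i (2/√π) F(t). Then ∫_{−∞}^{∞} g(γ t) · conj(g(γ' t)) dt = 2 √(π/(γ² + γ'²)). -/
open MeasureTheory Real

/-- `g(t) = e^{-t²} + i (2/√π) F(t)`. -/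
noncomputable def gFun (t : ℝ) : ℂ :=
  ((Real.exp (-t ^ 2) : ℝ) : ℂ) +
    Complex.I * (((2 / Real.sqrt Real.pi) * dawson t : ℝ) : ℂ)

open scoped FourierTransform SchwartzMap ContDiff ComplexConjugate

lemma coeFn_fourier_toLp_ae_eq {f : ℝ → ℂ} (hf : Integrable f) (hf2 : MemLp f 2) :
    (𝓕 (hf2.toLp f) : Lp ℂ 2 (volume : Measure ℝ)) =ᵐ[volume] 𝓕 f := by
  have hcont : Continuous (𝓕 f) :=
    VectorFourier.fourierIntegral_continuous Real.continuous_fourierChar continuous_inner hf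
  refine ae_eq_of_integral_contDiff_smul_eq
    ((Lp.memLp _).locallyIntegrable (by norm_num)) hcont.locallyIntegrable fun φ hφ hφc ↦ ?_
  have hc : HasCompactSupport (Complex.ofRealCLM ∘ φ) := hφc.comp_left rfl
  have hs : ContDiff ℝ ∞ (Complex.ofRealCLM ∘ φ) := by fun_prop
  let ψ : 𝓢(ℝ, ℂ) := hc.toSchwartzMap hs
  have hψ (x : ℝ) : ψ x = (φ x : ℂ) := rfl
  have key := DFunLike.congr_fun (Lp.fourier_toTemperedDistribution_eq (hf2.toLp f)) ψ
  rw [TemperedDistribution.fourier_apply, Lp.toTemperedDistribution_apply,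
    Lp.toTemperedDistribution_apply] at key
  have flip : ∫ x, (𝓕 ψ) x • f x = ∫ x, ψ x • 𝓕 f x := by
    simpa [SchwartzMap.fourier_coe] using! VectorFourier.integral_fourierIntegral_smul_eq_flip
      (L := innerₗ ℝ) Real.continuous_fourierChar continuous_inner ψ.integrable hf
  calc ∫ x, φ x • (𝓕 (hf2.toLp f) : Lp ℂ 2 (volume : Measure ℝ)) x
      = ∫ x, (𝓕 ψ) x • (hf2.toLp f) x := by simpa [hψ] using key.symm
    _ = ∫ x, (𝓕 ψ) x • f x := by
      refine integral_congr_ae ?_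
      filter_upwards [hf2.coeFn_toLp] with x hx
      rw [hx]
    _ = ∫ x, φ x • 𝓕 f x := by simpa [hψ] using flip

lemma integral_fourier_mul_conj_fourier {f g : ℝ → ℂ} (hf : Integrable f) (hf2 : MemLp f 2)
    (hg : Integrable g) (hg2 : MemLp g 2) :
    ∫ t, 𝓕 f t * conj (𝓕 g t) = ∫ u, f u * conj (g u) := by
  have h := Lp.inner_fourier_eq (hg2.toLp g) (hf2.toLp f)
  rw [L2.inner_def, L2.inner_def] at h
  simp only [RCLike.inner_apply] at h
  calc _ = _ := integral_congr_ae ?_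
    _ = _ := h
    _ = _ := integral_congr_ae ?_
  · filter_upwards [coeFn_fourier_toLp_ae_eq hf hf2, coeFn_fourier_toLp_ae_eq hg hg2] with x h1 h2
    rw [h1, h2]
  · filter_upwards [hf2.coeFn_toLp, hg2.coeFn_toLp] with x h1 h2
    rw [h1, h2]
lemma integrable_exp_neg_sq_div_four : Integrable fun s : ℝ ↦ Real.exp (-s ^ 2 / 4) := by
  simpa [div_eq_inv_mul] using integrable_exp_neg_mul_sq (b := (4 : ℝ)⁻¹) (by norm_num)

lemma integral_exp_neg_sq_div_four_mul_cos (x : ℝ) :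
    ∫ s in Set.Ioi (0 : ℝ), Real.exp (-s ^ 2 / 4) * Real.cos (x * s) =
      √π * Real.exp (-x ^ 2) := by
  have h := fourierIntegral_gaussian (b := ((1 / 4 : ℝ) : ℂ)) (by norm_num) (x : ℂ)
  have hr : ((π : ℂ) / ((1 / 4 : ℝ) : ℂ)) ^ (1 / 2 : ℂ) * Complex.exp (-x ^ 2 / (4 * (1 / 4 : ℝ))) =
      ((2 * √π * Real.exp (-x ^ 2) : ℝ) : ℂ) := by
    have h4 : √(π / (1 / 4)) = 2 * √π := by
      rw [show π / (1 / 4) = 2 ^ 2 * π by ring, Real.sqrt_mul (by norm_num),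
        Real.sqrt_sq (by norm_num)]
    rw [← h4, Real.sqrt_eq_rpow, Complex.ofReal_mul, Complex.ofReal_cpow (by positivity)]
    push_cast
    congr 2
    ring
  have hint : Integrable fun s : ℝ ↦
      Complex.exp (Complex.I * x * s) * Complex.exp (-((1 / 4 : ℝ) : ℂ) * s ^ 2) := by
    refine (integrable_exp_neg_sq_div_four.ofReal (𝕜 := ℂ)).mono
      (by fun_prop) (.of_forall fun s ↦ le_of_eq ?_)
    simp [Complex.norm_exp, ← Complex.ofReal_pow]
    ring
  rw [hr] at h
  have hre := congrArg Complex.re h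
  rw [Complex.ofReal_re, ← Complex.reCLM_apply, ← Complex.reCLM.integral_comp_comm hint] at hre
  have heven := integral_comp_abs (f := fun s ↦ Real.exp (-s ^ 2 / 4) * Real.cos (x * s))
  have hpt (s : ℝ) : Complex.reCLM
      (Complex.exp (Complex.I * x * s) * Complex.exp (-((1 / 4 : ℝ) : ℂ) * s ^ 2)) =
      Real.exp (-|s| ^ 2 / 4) * Real.cos (x * |s|) := by
    have hcos : Real.cos (x * |s|) = Real.cos (x * s) := by
      rcases abs_choice s with hs | hs <;> simp [hs]
    have he : Complex.exp (-((1 / 4 : ℝ) : ℂ) * s ^ 2) = ((Real.exp (-s ^ 2 / 4) : ℝ) : ℂ) := by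
      push_cast
      congr 1
      ring
    rw [hcos, sq_abs, he, Complex.reCLM_apply, Complex.re_mul_ofReal,
      show Complex.I * x * s = ((x * s : ℝ) : ℂ) * Complex.I by push_cast; ring,
      Complex.exp_ofReal_mul_I_re, mul_comm]
  simp_rw [hpt] at hre
  linarith

lemma conj_gFun_eq (x : ℝ) :
    conj (gFun x) = ((√π)⁻¹ : ℝ) * ∫ s in Set.Ioi (0 : ℝ),
      Complex.exp (((-(x * s) : ℝ) : ℂ) * Complex.I) * (Real.exp (-s ^ 2 / 4) : ℝ) := by
  have hc : IntegrableOn (fun s ↦ Real.exp (-s ^ 2 / 4) * Real.cos (x * s)) (Set.Ioi 0) :=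
    (integrable_exp_neg_sq_div_four.mul_bdd (c := 1) (by fun_prop)
      (.of_forall fun s ↦ Real.abs_cos_le_one _)).integrableOn
  have hs : IntegrableOn (fun s ↦ Real.exp (-s ^ 2 / 4) * Real.sin (x * s)) (Set.Ioi 0) :=
    (integrable_exp_neg_sq_div_four.mul_bdd (c := 1) (by fun_prop)
      (.of_forall fun s ↦ Real.abs_sin_le_one _)).integrableOn
  have hpt (s : ℝ) :
      Complex.exp (((-(x * s) : ℝ) : ℂ) * Complex.I) * (Real.exp (-s ^ 2 / 4) : ℝ) =
      ((Real.exp (-s ^ 2 / 4) * Real.cos (x * s) : ℝ) : ℂ) -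
        ((Real.exp (-s ^ 2 / 4) * Real.sin (x * s) : ℝ) : ℂ) * Complex.I := by
    rw [Complex.exp_mul_I, ← Complex.ofReal_cos, ← Complex.ofReal_sin, Real.cos_neg, Real.sin_neg]
    push_cast
    ring
  simp_rw [hpt]
  rw [integral_sub hc.ofReal (hs.ofReal.mul_const _), integral_mul_const, integral_complex_ofReal,
    integral_complex_ofReal, integral_exp_neg_sq_div_four_mul_cos, gFun, dawson]
  generalize ∫ s in Set.Ioi (0 : ℝ), Real.exp (-s ^ 2 / 4) * Real.sin (x * s) = S
  have hπ : (√π : ℂ) ≠ 0 := by simp [Real.pi_pos.le, Real.pi_ne_zero]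
  simp only [map_add, map_mul, Complex.conj_ofReal, Complex.conj_I]
  push_cast
  field_simp
  ring

/-- The half-line Gaussian whose Fourier transform is `t ↦ conj (g (γ t))`. -/
noncomputable def halfGaussian (γ : ℝ) : ℝ → ℂ :=
  (Set.Ioi 0).indicator fun u ↦ ((2 * √π / γ * Real.exp (-(π / γ) ^ 2 * u ^ 2) : ℝ) : ℂ)

lemma integrable_and_memLp_halfGaussian {γ : ℝ} (hγ : 0 < γ) :
    Integrable (halfGaussian γ) ∧ MemLp (halfGaussian γ) 2 := by
  have hb : 0 < (π / γ) ^ 2 := by positivity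
  have hi : Integrable fun u ↦ ((2 * √π / γ * Real.exp (-(π / γ) ^ 2 * u ^ 2) : ℝ) : ℂ) :=
    ((integrable_exp_neg_mul_sq hb).const_mul _).ofReal
  refine ⟨hi.indicator measurableSet_Ioi, MemLp.indicator measurableSet_Ioi ?_⟩
  refine (memLp_two_iff_integrable_sq_norm hi.aestronglyMeasurable).2 ?_
  refine ((integrable_exp_neg_mul_sq (b := 2 * (π / γ) ^ 2) (by positivity)).const_mul
    ((2 * √π / γ) ^ 2)).congr (.of_forall fun u ↦ ?_)
  simp only [Complex.norm_real, Real.norm_eq_abs, sq_abs, mul_pow, ← Real.exp_nat_mul]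
  congr 2
  push_cast
  ring

lemma fourier_halfGaussian {γ : ℝ} (hγ : 0 < γ) (t : ℝ) :
    𝓕 (halfGaussian γ) t = conj (gFun (γ * t)) := by
  have hb : 0 < 2 * π / γ := by positivity
  have hsub := integral_comp_mul_left_Ioi (fun s : ℝ ↦
    Complex.exp (((-(γ * t * s) : ℝ) : ℂ) * Complex.I) * (Real.exp (-s ^ 2 / 4) : ℝ)) 0 hb
  rw [mul_zero, eq_inv_smul_iff₀ hb.ne'] at hsub
  rw [conj_gFun_eq, ← hsub, Real.fourier_real_eq_integral_exp_smul, Complex.real_smul,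
    ← mul_assoc, ← integral_const_mul, ← integral_indicator measurableSet_Ioi]
  congr 1 with u
  by_cases hu : u ∈ Set.Ioi (0 : ℝ)
  · have hπ : (√π)⁻¹ * (2 * π / γ) = 2 * √π / γ := by
      have h := Real.sq_sqrt Real.pi_pos.le
      field_simp
      linarith
    have harg : -(γ * t * (2 * π / γ * u)) = -2 * π * u * t := by field_simp
    have hexp : -(2 * π / γ * u) ^ 2 / 4 = -(π / γ) ^ 2 * u ^ 2 := by ring
    simp only [halfGaussian, Set.indicator_of_mem hu, harg, hexp, smul_eq_mul, ← hπ]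
    push_cast
    ring
  · simp [halfGaussian, Set.indicator_of_notMem hu]

lemma integral_halfGaussian_mul_conj {γ γ' : ℝ} (hγ : 0 < γ) (hγ' : 0 < γ') :
    ∫ u, halfGaussian γ' u * conj (halfGaussian γ u) =
      ((2 * √(π / (γ ^ 2 + γ' ^ 2)) : ℝ) : ℂ) := by
  have hpt (u : ℝ) : halfGaussian γ' u * conj (halfGaussian γ u) =
      (Set.Ioi 0).indicator (fun u ↦ ((4 * π / (γ * γ') *
        Real.exp (-((π / γ) ^ 2 + (π / γ') ^ 2) * u ^ 2) : ℝ) : ℂ)) u := by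
    by_cases hu : u ∈ Set.Ioi (0 : ℝ)
    · simp only [halfGaussian, Set.indicator_of_mem hu, Complex.conj_ofReal, ← Complex.ofReal_mul]
      congr 1
      rw [neg_add, add_mul, Real.exp_add]
      have h := Real.sq_sqrt Real.pi_pos.le
      field_simp
      rw [h]
      ring
    · simp [halfGaussian, Set.indicator_of_notMem hu]
  simp_rw [hpt]
  rw [integral_indicator measurableSet_Ioi, integral_complex_ofReal, integral_const_mul,
    integral_gaussian_Ioi]
  congr 1
  have h : π / ((π / γ) ^ 2 + (π / γ') ^ 2) = (γ * γ' / π) ^ 2 * (π / (γ ^ 2 + γ' ^ 2)) := by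
    field_simp
    ring
  rw [h, Real.sqrt_mul (by positivity), Real.sqrt_sq (by positivity)]
  field_simp
  ring

/-- Cross-correlation of scaled copies of `g`:
`∫_{-∞}^∞ g(γt) conj(g(γ't)) dt = 2 √(π/(γ² + γ'²))`. -/
theorem g_cross_correlation (γ γ' : ℝ) (hγ : 0 < γ) (hγ' : 0 < γ') :
    ∫ t : ℝ, gFun (γ * t) * (starRingEnd ℂ) (gFun (γ' * t)) =
      ((2 * Real.sqrt (Real.pi / (γ ^ 2 + γ' ^ 2)) : ℝ) : ℂ) := by
  have hf := integrable_and_memLp_halfGaussian hγ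
  have hf' := integrable_and_memLp_halfGaussian hγ'
  rw [← integral_halfGaussian_mul_conj hγ hγ',
    ← integral_fourier_mul_conj_fourier hf'.1 hf'.2 hf.1 hf.2]
  simp_rw [fourier_halfGaussian hγ, fourier_halfGaussian hγ', Complex.conj_conj, mul_comm]
end

section
/- Let M be a positive integer, α_1,…,α_M ∈ ℂ and γ_1,…,γ_M ∈ ℂ with Re(γ_m²) > 0 for every m. Then for every real x > 0, |F(x) − x Σ_{m=1}^M α_m / (1 + (2 γ_m x)²)| ≤ (√π/2) · (1 + e^{−1/2} Σ_{m=1}^M |α_m| / √(2 Re(γ_m²))). -/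
open MeasureTheory Real

theorem abs_dawson_le (x : ℝ) : |dawson x| ≤ √π / 2 := by
  have hg : (fun t : ℝ => Real.exp (-t ^ 2 / 4)) = fun t => Real.exp (-(1 / 4) * t ^ 2) := by
    funext t; congr 1; ring
  have hint : IntegrableOn (fun t : ℝ => Real.exp (-t ^ 2 / 4)) (Set.Ioi 0) := by
    rw [hg]; exact (integrable_exp_neg_mul_sq (by norm_num)).integrableOn
  have hval : ∫ t in Set.Ioi (0:ℝ), Real.exp (-t ^ 2 / 4) = √π := by
    rw [hg, integral_gaussian_Ioi, show π / (1 / 4) = 2 ^ 2 * π by ring,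
      Real.sqrt_mul (by norm_num), Real.sqrt_sq (by norm_num)]
    ring
  have h := norm_integral_le_of_norm_le hint
    (f := fun t => Real.exp (-t ^ 2 / 4) * Real.sin (x * t))
    (Filter.Eventually.of_forall fun t => by
      rw [norm_mul, Real.norm_eq_abs, Real.norm_eq_abs, abs_of_pos (Real.exp_pos _)]
      exact mul_le_of_le_one_right (Real.exp_pos _).le (Real.abs_sin_le_one _))
  rw [hval, Real.norm_eq_abs] at h
  rw [dawson, abs_mul, abs_of_pos (by norm_num : (0:ℝ) < 1 / 2)]
  linarith

theorem four_mul_sqrt_re_sq_mul_le_norm (γ : ℂ) (hγ : 0 < (γ ^ 2).re) (x : ℝ) :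
    4 * √((γ ^ 2).re) * x ≤ ‖1 + (2 * γ * x) ^ 2‖ := by
  refine le_trans ?_ (Complex.re_le_norm _)
  have he : (1 + (2 * γ * x) ^ 2 : ℂ) = 1 + ((4 * x ^ 2 : ℝ) : ℂ) * γ ^ 2 := by
    push_cast; ring
  rw [he, Complex.add_re, Complex.re_ofReal_mul, Complex.one_re]
  nlinarith [sq_nonneg (2 * √((γ ^ 2).re) * x - 1), Real.sq_sqrt hγ.le]

theorem sqrt_two_le_two_mul_sqrt_pi_mul_exp : √2 ≤ 2 * √π * Real.exp (-1 / 2) := by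
  have h1 : √2 ≤ √π := Real.sqrt_le_sqrt (by linarith [Real.pi_gt_three])
  have h2 : (1 / 2 : ℝ) ≤ Real.exp (-1 / 2) := by
    linarith [Real.add_one_le_exp (-1 / 2 : ℝ)]
  nlinarith [Real.sqrt_nonneg π]

theorem norm_mul_div_one_add_sq_le (α γ : ℂ) (hγ : 0 < (γ ^ 2).re) {x : ℝ} (hx : 0 < x) :
    ‖(x : ℂ) * (α / (1 + (2 * γ * x) ^ 2))‖ ≤
      √π / 2 * (Real.exp (-1 / 2) * (‖α‖ / √(2 * (γ ^ 2).re))) := by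
  have hs : 0 < √((γ ^ 2).re) := Real.sqrt_pos.2 hγ
  have hn := four_mul_sqrt_re_sq_mul_le_norm γ hγ x
  rw [norm_mul, norm_div, Complex.norm_real, Real.norm_of_nonneg hx.le,
    Real.sqrt_mul (by norm_num)]
  calc x * (‖α‖ / ‖1 + (2 * γ * x) ^ 2‖)
      ≤ x * (‖α‖ / (4 * √((γ ^ 2).re) * x)) := by gcongr
    _ = √2 * (‖α‖ / (4 * √2 * √((γ ^ 2).re))) := by field_simp
    _ ≤ (2 * √π * Real.exp (-1 / 2)) * (‖α‖ / (4 * √2 * √((γ ^ 2).re))) := by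
        gcongr; exact sqrt_two_le_two_mul_sqrt_pi_mul_exp
    _ = √π / 2 * (Real.exp (-1 / 2) * (‖α‖ / (√2 * √((γ ^ 2).re)))) := by
        field_simp; ring

/-- Error bound away from zero for the rational approximation of Dawson's integral. -/
theorem dawson_rational_error_away_from_zero (M : ℕ) (hM : 0 < M) (α γ : Fin M → ℂ)
    (hγ : ∀ m, 0 < ((γ m ^ 2).re)) :
    ∀ x : ℝ, 0 < x →
      ‖((dawson x : ℝ) : ℂ) - (x : ℂ) * ∑ m, α m / (1 + (2 * γ m * x) ^ 2)‖ ≤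
        (Real.sqrt Real.pi / 2) *
          (1 + Real.exp (-1 / 2) * ∑ m, ‖α m‖ / Real.sqrt (2 * ((γ m ^ 2).re))) := by
  intro x hx
  refine (norm_sub_le _ _).trans ?_
  rw [mul_add, mul_one, Complex.norm_real, Finset.mul_sum, Finset.mul_sum, Finset.mul_sum]
  exact add_le_add (abs_dawson_le x)
    (norm_sum_le_of_le _ fun m _ => norm_mul_div_one_add_sq_le (α m) (γ m) (hγ m) hx)
end

section
/- Let σ > 0 and t ∈ ℝ be fixed, and for a > −1 define S(a) = (1/√π) e^{i a π/2} Σ_{n=0}^∞ (i^n/n!) (√2/σ)^{n+a} Γ((a+n+1)/2) t^n. Then S is differentiable on (−1, ∞) and its derivative is S'(a) = (1/√π) e^{i a π/2} Σ_{n=0}^∞ (i^n/n!) (√2/σ)^{n+a} Γ((a+n+1)/2) · [log(√2/σ) + (1/2) ψ((a+n+1)/2) + iπ/2] t^n, where both series converge absolutely. -/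
open MeasureTheory Real

/-- The digamma (Psi) function `ψ = Γ'/Γ`. -/
noncomputable def digammaFn (x : ℝ) : ℝ := deriv Real.Gamma x / Real.Gamma x

/-- The `n`-th term of the series `S(a)`:
`(iⁿ/n!) (√2/σ)^{n+a} Γ((a+n+1)/2) tⁿ`. -/
noncomputable def sTerm (σ t a : ℝ) (n : ℕ) : ℂ :=
  (Complex.I ^ n / (n.factorial : ℂ)) *
    (((Real.sqrt 2 / σ) ^ ((n : ℝ) + a) : ℝ) : ℂ) *
    ((Real.Gamma ((a + n + 1) / 2) : ℝ) : ℂ) * (t : ℂ) ^ n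

/-- The `n`-th term of the derivative series `S'(a)`: the term of `S(a)` multiplied by
`log(√2/σ) + (1/2) ψ((a+n+1)/2) + iπ/2`. -/
noncomputable def sTermDeriv (σ t a : ℝ) (n : ℕ) : ℂ :=
  sTerm σ t a n *
    (((Real.log (Real.sqrt 2 / σ) + (1 / 2) * digammaFn ((a + n + 1) / 2) : ℝ) : ℂ) +
      Complex.I * Real.pi / 2)

theorem Real.Gamma_add_half_le {s : ℝ} (hs : 0 < s) : Gamma (s + 1 / 2) ≤ √s * Gamma s := by
  have h := Real.Gamma_mul_add_mul_le_rpow_Gamma_mul_rpow_Gamma hs (by linarith : 0 < s + 1)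
    (by norm_num : (0 : ℝ) < 1 / 2) (by norm_num : (0 : ℝ) < 1 / 2) (by norm_num)
  have hΓ := Gamma_pos_of_pos hs
  rw [← sqrt_eq_rpow, ← sqrt_eq_rpow, Gamma_add_one hs.ne', sqrt_mul hs.le] at h
  calc Gamma (s + 1 / 2) = Gamma (1 / 2 * s + 1 / 2 * (s + 1)) := by ring_nf
    _ ≤ √(Gamma s) * (√s * √(Gamma s)) := h
    _ = √s * (√(Gamma s) * √(Gamma s)) := by ring
    _ = √s * Gamma s := by rw [mul_self_sqrt hΓ.le]

theorem summable_pow_div_factorial_mul_Gamma {y b : ℝ} (hy : 0 ≤ y) (hb : -1 < b) :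
    Summable fun n : ℕ => y ^ n / n.factorial * Gamma ((b + n + 1) / 2) := by
  refine summable_of_ratio_norm_eventually_le (r := 1 / 2) (by norm_num) ?_
  filter_upwards [Filter.eventually_ge_atTop ⌈b⌉₊, Filter.eventually_ge_atTop ⌈4 * y ^ 2⌉₊]
    with n hn₁ hn₂
  rw [Nat.ceil_le] at hn₁ hn₂
  have hn : (0 : ℝ) ≤ n := n.cast_nonneg
  have hs : 0 < (b + n + 1) / 2 := by linarith
  have hs' : 0 < (b + (n + 1 : ℕ) + 1) / 2 := by push_cast; linarith
  have hΓ := Gamma_pos_of_pos hs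
  have hΓ' := Gamma_pos_of_pos hs'
  rw [norm_of_nonneg (by positivity), norm_of_nonneg (by positivity)]
  have hw : √((b + n + 1) / 2) ≤ √(n + 1) := sqrt_le_sqrt (by linarith)
  have hyw : y ≤ √(n + 1) / 2 := by
    have : 2 * y ≤ √(n + 1) := le_sqrt_of_sq_le (by nlinarith)
    linarith
  have hyw' : y * √((b + n + 1) / 2) ≤ (n + 1) / 2 := by
    calc y * √((b + n + 1) / 2) ≤ √(n + 1) / 2 * √(n + 1) := by gcongr
      _ = (√(n + 1) * √(n + 1)) / 2 := by ring
      _ = (n + 1) / 2 := by rw [mul_self_sqrt (by positivity)]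
  have hΓle : Gamma ((b + (n + 1 : ℕ) + 1) / 2) ≤
      √((b + n + 1) / 2) * Gamma ((b + n + 1) / 2) := by
    convert Gamma_add_half_le hs using 2
    push_cast; ring
  calc y ^ (n + 1) / (n + 1).factorial * Gamma ((b + (n + 1 : ℕ) + 1) / 2)
      ≤ y ^ (n + 1) / (n + 1).factorial *
          (√((b + n + 1) / 2) * Gamma ((b + n + 1) / 2)) := by gcongr
    _ = y * √((b + n + 1) / 2) / (n + 1) *
          (y ^ n / n.factorial * Gamma ((b + n + 1) / 2)) := by
        rw [Nat.factorial_succ, pow_succ]; push_cast; field_simp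
    _ ≤ 1 / 2 * (y ^ n / n.factorial * Gamma ((b + n + 1) / 2)) := by
        refine mul_le_mul_of_nonneg_right ?_ (by positivity)
        rw [div_le_iff₀ (by positivity)]
        linarith

theorem hasDerivAt_Gamma_of_pos {s : ℝ} (hs : 0 < s) : HasDerivAt Gamma (deriv Gamma s) s :=
  (differentiableAt_Gamma fun m => by
    have : (0 : ℝ) ≤ m := m.cast_nonneg
    linarith).hasDerivAt

theorem Gamma_le_add_of_mem_Icc {p q s : ℝ} (hp : 0 < p) (hs : s ∈ Set.Icc p q) :
    Gamma s ≤ Gamma p + Gamma q := by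
  have hq : 0 < q := hp.trans_le (hs.1.trans hs.2)
  exact (convexOn_Gamma.le_max_of_mem_Icc hp hq hs).trans
    (max_le_add_of_nonneg (Gamma_pos_of_pos hp).le (Gamma_pos_of_pos hq).le)

theorem abs_deriv_Gamma_le {p q s h : ℝ} (hp : 0 < p) (hh : 0 < h) (hps : p + h ≤ s)
    (hsq : s + h ≤ q) : |deriv Gamma s| ≤ (Gamma p + Gamma q) / h := by
  have hs : 0 < s := by linarith
  have hd := hasDerivAt_Gamma_of_pos hs
  have h₁ := convexOn_Gamma.le_slope_of_hasDerivAt (x := s) (y := s + h) hs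
    (show 0 < s + h by linarith) (by linarith) hd
  have h₂ := convexOn_Gamma.slope_le_of_hasDerivAt (x := s - h) (y := s)
    (show 0 < s - h by linarith) hs (by linarith) hd
  have hs₁ := Gamma_le_add_of_mem_Icc hp (show s + h ∈ Set.Icc p q from ⟨by linarith, hsq⟩)
  have hs₂ := Gamma_le_add_of_mem_Icc hp
    (show s - h ∈ Set.Icc p q from ⟨by linarith, by linarith⟩)
  have hpos := Gamma_pos_of_pos hs
  rw [slope_def_field, add_sub_cancel_left, le_div_iff₀ hh] at h₁
  rw [slope_def_field, sub_sub_cancel, div_le_iff₀ hh] at h₂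
  rw [abs_le, le_div_iff₀ hh, neg_le, le_div_iff₀ hh]
  constructor <;> linarith

theorem norm_sTerm {σ : ℝ} (hσ : 0 < σ) (t : ℝ) {b : ℝ} (hb : -1 < b) (n : ℕ) :
    ‖sTerm σ t b n‖ = (√2 / σ) ^ b *
      ((√2 / σ * |t|) ^ n / n.factorial * Gamma ((b + n + 1) / 2)) := by
  have hx : 0 < √2 / σ := by positivity
  have hn : (0 : ℝ) ≤ n := n.cast_nonneg
  have hΓ := Gamma_pos_of_pos (show 0 < (b + n + 1) / 2 by linarith)
  rw [sTerm, norm_mul, norm_mul, norm_mul, norm_div, norm_pow, norm_pow, Complex.norm_I,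
    Complex.norm_real, Complex.norm_real, Complex.norm_real, Complex.norm_natCast,
    norm_of_nonneg hΓ.le, norm_of_nonneg (by positivity), rpow_add hx, rpow_natCast,
    Real.norm_eq_abs, one_pow, mul_pow]
  ring

theorem summable_norm_sTerm {σ : ℝ} (hσ : 0 < σ) (t : ℝ) {a : ℝ} (ha : -1 < a) :
    Summable fun n : ℕ => ‖sTerm σ t a n‖ := by
  simp_rw [norm_sTerm hσ t ha]
  exact (summable_pow_div_factorial_mul_Gamma (by positivity) ha).mul_left _

theorem hasDerivAt_sTerm {σ : ℝ} (hσ : 0 < σ) (t : ℝ) {b : ℝ} (hb : -1 < b) (n : ℕ) :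
    HasDerivAt (fun b => sTerm σ t b n)
      (sTerm σ t b n *
        ((log (√2 / σ) + (1 / 2) * digammaFn ((b + n + 1) / 2) : ℝ) : ℂ)) b := by
  have hx : 0 < √2 / σ := by positivity
  have hn : (0 : ℝ) ≤ n := n.cast_nonneg
  have hs : 0 < (b + n + 1) / 2 := by linarith
  have hΓ : (Gamma ((b + n + 1) / 2) : ℂ) ≠ 0 := by
    exact_mod_cast (Gamma_pos_of_pos hs).ne'
  have h₁ := (((hasDerivAt_id b).const_add (n : ℝ)).const_rpow hx).ofReal_comp
  have h₂ := ((hasDerivAt_Gamma_of_pos hs).comp b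
    ((((hasDerivAt_id b).add_const (n : ℝ)).add_const 1).div_const 2)).ofReal_comp
  have h := ((h₁.const_mul (Complex.I ^ n / (n.factorial : ℂ))).mul h₂).mul_const ((t : ℂ) ^ n)
  refine h.congr_deriv ?_
  simp only [sTerm, digammaFn, Function.comp, id]
  push_cast
  field_simp

theorem norm_sTerm_mul_le {σ : ℝ} (hσ : 0 < σ) (t : ℝ) {a b δ : ℝ} (hδ : 0 < δ)
    (ha : -1 < a - 2 * δ) (hb : |b - a| ≤ δ) (n : ℕ) :
    ‖sTerm σ t b n * ((log (√2 / σ) + (1 / 2) * digammaFn ((b + n + 1) / 2) : ℝ) : ℂ)‖ ≤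
      exp (|log (√2 / σ)| * (|a| + δ)) * (|log (√2 / σ)| + 1 / δ) *
        ((√2 / σ * |t|) ^ n / n.factorial * Gamma ((a - 2 * δ + n + 1) / 2) +
          (√2 / σ * |t|) ^ n / n.factorial * Gamma ((a + 2 * δ + n + 1) / 2)) := by
  have hx : 0 < √2 / σ := by positivity
  have hn : (0 : ℝ) ≤ n := n.cast_nonneg
  have hb' := abs_le.mp hb
  have hs : 0 < (b + n + 1) / 2 := by linarith
  have hp : 0 < (a - 2 * δ + n + 1) / 2 := by linarith
  have hΓ := Gamma_pos_of_pos hs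
  set x := √2 / σ
  set c := (x * |t|) ^ n / n.factorial
  have hc : 0 ≤ c := by positivity
  set B := Gamma ((a - 2 * δ + n + 1) / 2) + Gamma ((a + 2 * δ + n + 1) / 2)
  have hΓB : Gamma ((b + n + 1) / 2) ≤ B :=
    Gamma_le_add_of_mem_Icc hp ⟨by linarith, by linarith⟩
  have hΓ'B : |deriv Gamma ((b + n + 1) / 2)| ≤ B / (δ / 2) :=
    abs_deriv_Gamma_le hp (by positivity) (by linarith) (by linarith)
  have hrpow : x ^ b ≤ exp (|log x| * (|a| + δ)) := by
    rw [rpow_def_of_pos hx, exp_le_exp]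
    refine (le_abs_self _).trans ?_
    rw [abs_mul]
    gcongr
    have := abs_add_le a (b - a)
    rw [add_sub_cancel] at this
    linarith
  have hfactor : Gamma ((b + n + 1) / 2) *
      |log x + 1 / 2 * digammaFn ((b + n + 1) / 2)| ≤ (|log x| + 1 / δ) * B := by
    calc Gamma ((b + n + 1) / 2) * |log x + 1 / 2 * digammaFn ((b + n + 1) / 2)|
        = |log x * Gamma ((b + n + 1) / 2) + 1 / 2 * deriv Gamma ((b + n + 1) / 2)| := by
          nth_rw 1 [← abs_of_pos hΓ]
          rw [← abs_mul, digammaFn]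
          congr 1
          field_simp
      _ ≤ |log x| * Gamma ((b + n + 1) / 2) + 1 / 2 * |deriv Gamma ((b + n + 1) / 2)| := by
          refine (abs_add_le _ _).trans_eq ?_
          rw [abs_mul, abs_mul, abs_of_pos hΓ, abs_of_pos (by norm_num : (0 : ℝ) < 1 / 2)]
      _ ≤ |log x| * B + 1 / 2 * (B / (δ / 2)) := by gcongr
      _ = (|log x| + 1 / δ) * B := by field_simp
  rw [norm_mul, norm_sTerm hσ t (by linarith), Complex.norm_real, Real.norm_eq_abs]
  calc x ^ b * (c * Gamma ((b + n + 1) / 2)) * |log x + 1 / 2 * digammaFn ((b + n + 1) / 2)|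
      = x ^ b * c * (Gamma ((b + n + 1) / 2) *
          |log x + 1 / 2 * digammaFn ((b + n + 1) / 2)|) := by ring
    _ ≤ exp (|log x| * (|a| + δ)) * c * ((|log x| + 1 / δ) * B) := by gcongr
    _ = _ := by ring

/-- Differentiation of `S(a) = (1/√π) e^{iaπ/2} Σ_n sTerm σ t a n` with respect to the
fractional order `a`, with absolute convergence of both series, for `a > -1`. -/
theorem deriv_in_order (σ t : ℝ) (hσ : 0 < σ) (a : ℝ) (ha : -1 < a) :
    (Summable fun n : ℕ => ‖sTerm σ t a n‖) ∧
    (Summable fun n : ℕ => ‖sTermDeriv σ t a n‖) ∧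
    HasDerivAt
      (fun b : ℝ => ((1 / Real.sqrt Real.pi : ℝ) : ℂ) *
        Complex.exp (Complex.I * b * Real.pi / 2) * ∑' n : ℕ, sTerm σ t b n)
      (((1 / Real.sqrt Real.pi : ℝ) : ℂ) *
        Complex.exp (Complex.I * a * Real.pi / 2) * ∑' n : ℕ, sTermDeriv σ t a n) a := by
  obtain ⟨δ, hδ, hδa⟩ : ∃ δ : ℝ, 0 < δ ∧ -1 < a - 2 * δ :=
    ⟨(a + 1) / 4, by linarith, by linarith⟩
  have hsum := summable_norm_sTerm hσ t ha
  have hmajorant := ((summable_pow_div_factorial_mul_Gamma (y := √2 / σ * |t|) (by positivity)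
    hδa).add (summable_pow_div_factorial_mul_Gamma (y := √2 / σ * |t|) (b := a + 2 * δ)
      (by positivity) (by linarith))).mul_left
        (exp (|log (√2 / σ)| * (|a| + δ)) * (|log (√2 / σ)| + 1 / δ))
  have hsum' := hmajorant.of_nonneg_of_le (fun n => norm_nonneg _)
    (fun n => norm_sTerm_mul_le hσ t hδ hδa (b := a) (by simpa using hδ.le) n)
  have hprefactor := hsum.of_norm.mul_right (Complex.I * π / 2)
  have hderiv : ∀ n, sTermDeriv σ t a n = sTerm σ t a n *
      ((log (√2 / σ) + (1 / 2) * digammaFn ((a + n + 1) / 2) : ℝ) : ℂ) +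
        sTerm σ t a n * (Complex.I * π / 2) := fun n => mul_add _ _ _
  refine ⟨hsum, ?_, ?_⟩
  · simp_rw [hderiv]
    exact (hsum'.of_norm.add hprefactor).norm
  have hseries := hasDerivAt_tsum_of_isPreconnected hmajorant Metric.isOpen_ball
    (convex_ball a δ).isPreconnected
    (fun n b hb => hasDerivAt_sTerm hσ t (by
      have := abs_lt.mp (Metric.mem_ball.mp hb)
      linarith) n)
    (fun n b hb => norm_sTerm_mul_le hσ t hδ hδa (Metric.mem_ball.mp hb).le n)
    (Metric.mem_ball_self hδ) hsum.of_norm (Metric.mem_ball_self hδ)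
  have hexp : HasDerivAt (fun b : ℝ => Complex.exp (Complex.I * b * π / 2))
      (Complex.exp (Complex.I * a * π / 2) * (Complex.I * π / 2)) a := by
    refine HasDerivAt.cexp ?_
    simpa using ((Complex.ofRealCLM.hasDerivAt (x := a)).const_mul Complex.I).mul_const
      (π : ℂ) |>.div_const 2
  refine ((hexp.const_mul _).mul hseries).congr_deriv ?_
  simp_rw [hderiv]
  rw [hsum'.of_norm.tsum_add hprefactor, tsum_mul_right]
  ring
end

section
/- Let 0 < μ < 1 and σ > 0, and set f₀(s) = e^{−s²/(2σ²)} + i (2/√π) F(s/(√2 σ)). Then for every real t, the Riemann–Liouville fractional integral of order μ of f₀ based at −∞ converges absolutely and (1/Γ(μ)) ∫_{−∞}^{t} (t − s)^{μ−1} f₀(s) ds = √(2/π) ∫_0^∞ e^{−ω²/2} (ω/σ)^{−μ} e^{i(ω t/σ − μπ/2)} dω. -/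
open MeasureTheory Real

/-- `f₀(s) = e^{-s²/(2σ²)} + i (2/√π) F(s/(√2 σ))`. -/
noncomputable def f0 (σ : ℝ) (s : ℝ) : ℂ :=
  ((Real.exp (-s ^ 2 / (2 * σ ^ 2)) : ℝ) : ℂ) +
    Complex.I * (((2 / Real.sqrt Real.pi) * dawson (s / (Real.sqrt 2 * σ)) : ℝ) : ℂ)

/-- Euler's integral `∫₀^∞ u^(a-1) e^(-zu) du` is absolutely convergent for `0 < Re z`. -/
lemma integrableOn_rpow_mul_cexp_neg_mul {a : ℝ} (ha : 0 < a) {z : ℂ} (hz : 0 < z.re) :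
    IntegrableOn (fun u : ℝ => ((u ^ (a - 1) : ℝ) : ℂ) * Complex.exp (-(z * u)))
      (Set.Ioi 0) := by
  have h : IntegrableOn (fun u : ℝ => u ^ (a - 1) * Real.exp (-z.re * u)) (Set.Ioi 0) := by
    simpa using integrableOn_rpow_mul_exp_neg_mul_rpow (p := 1) (s := a - 1)
      (by linarith) one_pos hz
  refine Integrable.mono' h (by fun_prop) ?_
  refine (ae_restrict_iff' measurableSet_Ioi).2 (.of_forall fun u hu => ?_)
  have hu : (0 : ℝ) < u := hu
  simp [Complex.norm_exp, abs_of_nonneg (rpow_nonneg hu.le (a - 1))]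

lemma differentiableAt_integral_rpow_mul_cexp_neg_mul {a : ℝ} (ha : 0 < a) {z₀ : ℂ}
    (hz₀ : 0 < z₀.re) :
    DifferentiableAt ℂ (fun z : ℂ => ∫ u : ℝ in Set.Ioi 0,
      ((u ^ (a - 1) : ℝ) : ℂ) * Complex.exp (-(z * u))) z₀ := by
  have hbound : IntegrableOn (fun u : ℝ => u ^ a * Real.exp (-(z₀.re / 2) * u))
      (Set.Ioi 0) := by
    simpa using integrableOn_rpow_mul_exp_neg_mul_rpow (p := 1) (s := a)
      (by linarith) one_pos (half_pos hz₀)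
  refine (hasDerivAt_integral_of_dominated_loc_of_deriv_le
    (F := fun z u => ((u ^ (a - 1) : ℝ) : ℂ) * Complex.exp (-(z * u)))
    (F' := fun z u => ((u ^ (a - 1) : ℝ) : ℂ) * (Complex.exp (-(z * u)) * (-u)))
    (Metric.ball_mem_nhds z₀ (half_pos hz₀)) (.of_forall fun z => by fun_prop)
    (integrableOn_rpow_mul_cexp_neg_mul ha hz₀) (by fun_prop) ?_ hbound ?_).2.differentiableAt
  · refine (ae_restrict_iff' measurableSet_Ioi).2 (.of_forall fun u hu z hz => ?_)
    have hu : (0 : ℝ) < u := hu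
    have hre : z₀.re / 2 ≤ z.re := by
      have h1 := Complex.abs_re_le_norm (z - z₀)
      rw [mem_ball_iff_norm] at hz
      have h2 := neg_abs_le (z - z₀).re
      rw [Complex.sub_re] at h1 h2
      linarith
    have hpow : u ^ a = u ^ (a - 1) * u := by
      rw [← rpow_add_one hu.ne', sub_add_cancel]
    rw [norm_mul, norm_mul, Complex.norm_exp, norm_neg, Complex.norm_real, Complex.norm_real,
      norm_of_nonneg hu.le, norm_of_nonneg (rpow_nonneg hu.le _), hpow, mul_comm (Real.exp _),
      ← mul_assoc]
    gcongr
    simpa using mul_le_mul_of_nonneg_right hre hu.le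
  · refine .of_forall fun u z _ => HasDerivAt.const_mul _ (HasDerivAt.cexp ?_)
    simpa using (hasDerivAt_id z).mul_const (-(u : ℂ))

/-- Euler's integral with a complex rate:
`∫₀^∞ u^(a-1) e^(-zu) du = z^(-a) Γ(a)` for `0 < a` and `0 < Re z`. -/
lemma integral_rpow_mul_cexp_neg_mul {a : ℝ} (ha : 0 < a) {z : ℂ} (hz : 0 < z.re) :
    ∫ u : ℝ in Set.Ioi 0, ((u ^ (a - 1) : ℝ) : ℂ) * Complex.exp (-(z * u)) =
      (1 / z) ^ (a : ℂ) * (Real.Gamma a : ℂ) := by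
  have hopen : IsOpen {w : ℂ | 0 < w.re} := isOpen_lt continuous_const Complex.continuous_re
  have hF : AnalyticOnNhd ℂ (fun w : ℂ => ∫ u : ℝ in Set.Ioi 0,
      ((u ^ (a - 1) : ℝ) : ℂ) * Complex.exp (-(w * u))) {w : ℂ | 0 < w.re} :=
    DifferentiableOn.analyticOnNhd (fun w hw =>
      (differentiableAt_integral_rpow_mul_cexp_neg_mul ha hw).differentiableWithinAt) hopen
  have hG : AnalyticOnNhd ℂ (fun w : ℂ => (1 / w) ^ (a : ℂ) * (Real.Gamma a : ℂ))
      {w : ℂ | 0 < w.re} := by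
    refine DifferentiableOn.analyticOnNhd (fun w hw => ?_) hopen
    have hw : 0 < w.re := hw
    have hw0 : w ≠ 0 := fun h => by simp [h] at hw
    have hslit : 1 / w ∈ Complex.slitPlane := by
      refine Or.inl ?_
      rw [one_div, Complex.inv_re]
      exact div_pos hw (Complex.normSq_pos.2 hw0)
    exact (((differentiableAt_const 1).div differentiableAt_id hw0).cpow_const
      hslit |>.mul_const _).differentiableWithinAt
  have hconn : IsPreconnected {w : ℂ | 0 < w.re} := (convex_halfSpace_re_gt 0).isPreconnected
  have hreal : ∀ r : ℝ, 0 < r →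
      ∫ u : ℝ in Set.Ioi 0, ((u ^ (a - 1) : ℝ) : ℂ) * Complex.exp (-((r : ℂ) * u)) =
        (1 / (r : ℂ)) ^ (a : ℂ) * (Real.Gamma a : ℂ) := by
    intro r hr
    rw [← Complex.Gamma_ofReal, ← Complex.integral_cpow_mul_exp_neg_mul_Ioi (by simpa) hr]
    refine setIntegral_congr_fun measurableSet_Ioi fun u hu => ?_
    have hu : (0 : ℝ) < u := hu
    simp [Complex.ofReal_cpow hu.le]
  refine hF.eqOn_of_preconnected_of_frequently_eq hG hconn (z₀ := 1) (by simp) ?_ hz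
  have hlim : Filter.Tendsto (fun r : ℝ => (r : ℂ)) (nhdsWithin 1 {1}ᶜ) (nhdsWithin 1 {1}ᶜ) := by
    refine tendsto_nhdsWithin_iff.2 ⟨?_, ?_⟩
    · exact (Complex.continuous_ofReal.tendsto' 1 1 (by simp)).mono_left nhdsWithin_le_nhds
    · filter_upwards [self_mem_nhdsWithin] with r hr
      simpa using hr
  refine hlim.frequently (Filter.Eventually.frequently ?_)
  filter_upwards [nhdsWithin_le_nhds (lt_mem_nhds (zero_lt_one' ℝ))] with r hr using hreal r hr

/-- The one-sided Fourier transform of the standard Gaussian weight. -/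
noncomputable def gaussianHalfFourier (x : ℝ) : ℂ :=
  ∫ ω in Set.Ioi (0:ℝ), ((Real.exp (-ω ^ 2 / 2) : ℝ) : ℂ) * Complex.exp (Complex.I * (ω * x))

lemma norm_cexp_I_mul_ofReal_mul (ω x : ℝ) : ‖Complex.exp (Complex.I * (ω * x))‖ = 1 := by
  rw [← Complex.ofReal_mul, Complex.norm_exp_I_mul_ofReal]

lemma integrable_exp_neg_sq_div_two : Integrable (fun ω : ℝ => Real.exp (-ω ^ 2 / 2)) := by
  refine (integrable_exp_neg_mul_sq (b := 1 / 2) (by norm_num)).congr (.of_forall fun ω => ?_)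
  ring_nf

lemma integrable_mul_exp_neg_sq_div_two :
    Integrable (fun ω : ℝ => ω * Real.exp (-ω ^ 2 / 2)) := by
  refine (integrable_mul_exp_neg_mul_sq (b := 1 / 2) (by norm_num)).congr
    (.of_forall fun ω => ?_)
  ring_nf

lemma norm_exp_neg_sq_div_two_mul_cexp (ω x : ℝ) :
    ‖((Real.exp (-ω ^ 2 / 2) : ℝ) : ℂ) * Complex.exp (Complex.I * (ω * x))‖ =
      Real.exp (-ω ^ 2 / 2) := by
  rw [norm_mul, norm_cexp_I_mul_ofReal_mul, mul_one, Complex.norm_real,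
    norm_of_nonneg (Real.exp_pos _).le]

lemma integrable_exp_neg_sq_div_two_mul_cexp (x : ℝ) :
    Integrable (fun ω : ℝ =>
      ((Real.exp (-ω ^ 2 / 2) : ℝ) : ℂ) * Complex.exp (Complex.I * (ω * x))) :=
  integrable_exp_neg_sq_div_two.mono' (by fun_prop)
    (.of_forall fun ω => (norm_exp_neg_sq_div_two_mul_cexp ω x).le)

lemma continuous_gaussianHalfFourier : Continuous gaussianHalfFourier :=
  continuous_of_dominated (fun x => by fun_prop)
    (fun x => .of_forall fun ω => (norm_exp_neg_sq_div_two_mul_cexp ω x).le)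
    integrable_exp_neg_sq_div_two.integrableOn (.of_forall fun ω => by fun_prop)

/-- Integrating the derivative of `e^(-ω²/2 + iωx)` over the half line. -/
lemma I_mul_gaussianHalfFourier (x : ℝ) :
    Complex.I * x * gaussianHalfFourier x =
      (∫ ω in Set.Ioi (0:ℝ), ((ω * Real.exp (-ω ^ 2 / 2) : ℝ) : ℂ) *
        Complex.exp (Complex.I * (ω * x))) - 1 := by
  have hInt := (integrable_exp_neg_sq_div_two_mul_cexp x).integrableOn (s := Set.Ioi 0)
  have hInt' : IntegrableOn (fun ω : ℝ => ((ω * Real.exp (-ω ^ 2 / 2) : ℝ) : ℂ) *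
      Complex.exp (Complex.I * (ω * x))) (Set.Ioi 0) := by
    refine (integrable_mul_exp_neg_sq_div_two.norm.mono' (by fun_prop)
      (.of_forall fun ω => ?_)).integrableOn
    rw [norm_mul, norm_cexp_I_mul_ofReal_mul, mul_one, Complex.norm_real]
  have hderiv : ∀ ω ∈ Set.Ici (0:ℝ), HasDerivAt
      (fun ω : ℝ => ((Real.exp (-ω ^ 2 / 2) : ℝ) : ℂ) * Complex.exp (Complex.I * (ω * x)))
      (Complex.I * x * (((Real.exp (-ω ^ 2 / 2) : ℝ) : ℂ) * Complex.exp (Complex.I * (ω * x))) -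
        ((ω * Real.exp (-ω ^ 2 / 2) : ℝ) : ℂ) * Complex.exp (Complex.I * (ω * x))) ω := by
    intro ω _
    have h1 : HasDerivAt (fun ω : ℝ => Real.exp (-ω ^ 2 / 2))
        (Real.exp (-ω ^ 2 / 2) * (-(2 * ω) / 2)) ω := by
      simpa using (((hasDerivAt_id ω).pow 2).neg.div_const 2).exp
    have h2 : HasDerivAt (fun ω : ℝ => Complex.exp (Complex.I * (ω * x)))
        (Complex.exp (Complex.I * (ω * x)) * (Complex.I * (1 * x))) ω :=
      (((hasDerivAt_id ω).ofReal_comp.mul_const (x : ℂ)).const_mul Complex.I).cexp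
    refine (h1.ofReal_comp.mul h2).congr_deriv ?_
    push_cast
    ring
  have hlim : Filter.Tendsto
      (fun ω : ℝ => ((Real.exp (-ω ^ 2 / 2) : ℝ) : ℂ) * Complex.exp (Complex.I * (ω * x)))
      Filter.atTop (nhds 0) := by
    rw [tendsto_zero_iff_norm_tendsto_zero]
    simp_rw [norm_exp_neg_sq_div_two_mul_cexp]
    refine Real.tendsto_exp_atBot.comp ?_
    refine Filter.Tendsto.atBot_div_const two_pos ?_
    exact Filter.tendsto_neg_atTop_atBot.comp (Filter.tendsto_pow_atTop two_ne_zero)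
  have hftc := integral_Ioi_of_hasDerivAt_of_tendsto' hderiv
    ((hInt.const_mul _).sub hInt') hlim
  rw [integral_sub (hInt.const_mul _) hInt', integral_const_mul] at hftc
  simp only [Complex.ofReal_zero, zero_mul, mul_zero, Complex.exp_zero] at hftc
  norm_num at hftc
  rw [gaussianHalfFourier]
  push_cast
  linear_combination hftc

/-- The half-line Fourier transform of the Gaussian decays at least like `1 / |x|`. -/
lemma exists_norm_gaussianHalfFourier_le :
    ∃ C : ℝ, ∀ x, ‖gaussianHalfFourier x‖ ≤ C / (1 + |x|) := by
  set A := ∫ ω in Set.Ioi (0:ℝ), Real.exp (-ω ^ 2 / 2)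
  set B := ∫ ω in Set.Ioi (0:ℝ), ω * Real.exp (-ω ^ 2 / 2)
  refine ⟨A + (B + 1), fun x => ?_⟩
  have h0 : ‖gaussianHalfFourier x‖ ≤ A :=
    norm_integral_le_of_norm_le integrable_exp_neg_sq_div_two.integrableOn
      (.of_forall fun ω => (norm_exp_neg_sq_div_two_mul_cexp ω x).le)
  have h1 : |x| * ‖gaussianHalfFourier x‖ ≤ B + 1 := by
    have h := congrArg norm (I_mul_gaussianHalfFourier x)
    rw [norm_mul, norm_mul, Complex.norm_I, one_mul, Complex.norm_real, norm_eq_abs] at h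
    rw [h]
    refine (norm_sub_le _ _).trans ?_
    rw [norm_one]
    gcongr
    refine norm_integral_le_of_norm_le integrable_mul_exp_neg_sq_div_two.integrableOn
      ((ae_restrict_iff' measurableSet_Ioi).2 (.of_forall fun ω hω => ?_))
    rw [norm_mul, norm_cexp_I_mul_ofReal_mul, mul_one, Complex.norm_real,
      norm_of_nonneg (mul_nonneg (le_of_lt hω) (Real.exp_pos _).le)]
  rw [le_div_iff₀ (by positivity)]
  linarith

lemma integral_exp_neg_sq_div_two_mul_cos (x : ℝ) :
    ∫ ω in Set.Ioi (0:ℝ), Real.exp (-ω ^ 2 / 2) * Real.cos (ω * x) =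
      √(π / 2) * Real.exp (-x ^ 2 / 2) := by
  have h1 : ∫ ω : ℝ, Real.exp (-ω ^ 2 / 2) * Real.cos (ω * x) =
      2 * ∫ ω in Set.Ioi (0:ℝ), Real.exp (-ω ^ 2 / 2) * Real.cos (ω * x) := by
    rw [← integral_comp_abs (f := fun ω => Real.exp (-ω ^ 2 / 2) * Real.cos (ω * x))]
    refine integral_congr_ae (.of_forall fun ω => ?_)
    rcases abs_choice ω with h | h <;> simp [h]
  have h2 : ∫ ω : ℝ, ((Real.exp (-ω ^ 2 / 2) : ℝ) : ℂ) * Complex.exp (Complex.I * (ω * x)) =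
      ((√(2 * π) * Real.exp (-x ^ 2 / 2) : ℝ) : ℂ) := by
    have h := fourierIntegral_gaussian (b := 1 / 2) (by norm_num) x
    have hpow : (π / (1 / 2) : ℂ) ^ (1 / 2 : ℂ) = (√(2 * π) : ℝ) := by
      rw [Real.sqrt_eq_rpow, Complex.ofReal_cpow (by positivity)]
      push_cast
      ring_nf
    rw [hpow] at h
    push_cast
    convert h using 2
    · ext ω
      rw [mul_comm]
      ring_nf
    · ring_nf
  have h3 : ∫ ω : ℝ, Real.exp (-ω ^ 2 / 2) * Real.cos (ω * x) =
      √(2 * π) * Real.exp (-x ^ 2 / 2) := by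
    have h := integral_re (integrable_exp_neg_sq_div_two_mul_cexp x)
    rw [h2] at h
    simp only [RCLike.re_to_complex, Complex.ofReal_re] at h
    rw [← h]
    refine integral_congr_ae (.of_forall fun ω => ?_)
    simp only
    rw [← Complex.ofReal_mul, mul_comm Complex.I]
    simp [Complex.exp_ofReal_mul_I_re, -Complex.ofReal_exp, -Complex.ofReal_mul]
  have h4 : √(2 * π) = 2 * √(π / 2) := by
    rw [show 2 * π = 2 ^ 2 * (π / 2) by ring, Real.sqrt_mul (by norm_num),
      Real.sqrt_sq (by norm_num)]
  rw [h1, h4] at h3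
  linarith

lemma dawson_div_sqrt_two (x : ℝ) :
    dawson (x / √2) =
      √2 / 2 * ∫ ω in Set.Ioi (0:ℝ), Real.exp (-ω ^ 2 / 2) * Real.sin (ω * x) := by
  have hs : (0 : ℝ) < √2 := by positivity
  have h := integral_comp_mul_left_Ioi
    (fun t => Real.exp (-t ^ 2 / 4) * Real.sin (x / √2 * t)) 0 hs
  rw [mul_zero, smul_eq_mul, ← div_eq_inv_mul, eq_div_iff hs.ne'] at h
  rw [dawson, ← h, mul_comm (integral _ _), ← mul_assoc, one_div, ← div_eq_inv_mul]
  congr 1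
  refine integral_congr_ae (.of_forall fun ω => ?_)
  have e1 : -(√2 * ω) ^ 2 / 4 = -ω ^ 2 / 2 := by
    rw [mul_pow, Real.sq_sqrt (by norm_num)]
    ring
  have e2 : x / √2 * (√2 * ω) = ω * x := by
    field_simp
  simp only [e1, e2]

lemma f0_eq_gaussianHalfFourier {σ : ℝ} (hσ : 0 < σ) (s : ℝ) :
    f0 σ s = (√(2 / π) : ℝ) * gaussianHalfFourier (s / σ) := by
  have hcos : IntegrableOn (fun ω : ℝ => Real.exp (-ω ^ 2 / 2) * Real.cos (ω * (s / σ)))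
      (Set.Ioi 0) := by
    refine (integrable_exp_neg_sq_div_two.mul_bdd (c := 1) (by fun_prop)
      (.of_forall fun ω => ?_)).integrableOn
    simpa using Real.abs_cos_le_one _
  have hsin : IntegrableOn (fun ω : ℝ => Real.exp (-ω ^ 2 / 2) * Real.sin (ω * (s / σ)))
      (Set.Ioi 0) := by
    refine (integrable_exp_neg_sq_div_two.mul_bdd (c := 1) (by fun_prop)
      (.of_forall fun ω => ?_)).integrableOn
    simpa using Real.abs_sin_le_one _
  have hG : gaussianHalfFourier (s / σ) =
      ((∫ ω in Set.Ioi (0:ℝ), Real.exp (-ω ^ 2 / 2) * Real.cos (ω * (s / σ)) : ℝ) : ℂ) +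
        Complex.I *
          ((∫ ω in Set.Ioi (0:ℝ), Real.exp (-ω ^ 2 / 2) * Real.sin (ω * (s / σ)) : ℝ) : ℂ) := by
    rw [← integral_complex_ofReal, ← integral_complex_ofReal, ← integral_const_mul,
      ← integral_add hcos.ofReal (hsin.ofReal.const_mul _), gaussianHalfFourier]
    refine integral_congr_ae (.of_forall fun ω => ?_)
    simp only
    rw [← Complex.ofReal_mul, mul_comm Complex.I, Complex.exp_mul_I]
    push_cast
    ring
  have hsqrt : √(2 / π) * √(π / 2) = 1 := by
    rw [← Real.sqrt_mul (by positivity)]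
    have : 2 / π * (π / 2) = 1 := by field_simp
    rw [this, Real.sqrt_one]
  have hsqrt' : 2 / √π * (√2 / 2) = √(2 / π) := by
    rw [Real.sqrt_div (by norm_num)]
    ring
  rw [f0, hG, integral_exp_neg_sq_div_two_mul_cos, mul_comm (√2) σ, ← div_div s,
    dawson_div_sqrt_two, ← mul_assoc (2 / √π), hsqrt',
    show -s ^ 2 / (2 * σ ^ 2) = -(s / σ) ^ 2 / 2 by field_simp]
  have hsqrtC : ((√(2 / π) : ℝ) : ℂ) * ((√(π / 2) : ℝ) : ℂ) = 1 := by exact_mod_cast hsqrt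
  push_cast at hsqrtC ⊢
  linear_combination (-Complex.exp (-(s / σ : ℂ) ^ 2 / 2)) * hsqrtC

lemma continuous_f0 {σ : ℝ} (hσ : 0 < σ) : Continuous (f0 σ) := by
  simp_rw [funext (f0_eq_gaussianHalfFourier hσ)]
  exact continuous_const.mul (continuous_gaussianHalfFourier.comp (continuous_id.div_const σ))

lemma integrableOn_rpow_div_one_add_abs {μ σ : ℝ} (hμ0 : 0 < μ) (hμ1 : μ < 1) (hσ : 0 < σ)
    (t : ℝ) :
    IntegrableOn (fun u : ℝ => u ^ (μ - 1) / (1 + |(t - u) / σ|)) (Set.Ioi 0) := by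
  have hR : 0 < 2 * |t| + 1 := by positivity
  have hmeas : Measurable fun u : ℝ => u ^ (μ - 1) / (1 + |(t - u) / σ|) := by fun_prop
  rw [← Set.Ioc_union_Ioi_eq_Ioi hR.le]
  refine IntegrableOn.union ?_ ?_
  · have h : IntegrableOn (fun u : ℝ => u ^ (μ - 1)) (Set.Ioc 0 (2 * |t| + 1)) :=
      (intervalIntegrable_iff_integrableOn_Ioc_of_le hR.le).1
        (intervalIntegral.intervalIntegrable_rpow' (by linarith))
    refine Integrable.mono' h hmeas.aestronglyMeasurable
      ((ae_restrict_iff' measurableSet_Ioc).2 (.of_forall fun u hu => ?_))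
    have hpow : 0 ≤ u ^ (μ - 1) := rpow_nonneg hu.1.le _
    rw [norm_of_nonneg (by positivity)]
    exact div_le_self hpow (by linarith [abs_nonneg ((t - u) / σ)])
  · have h : IntegrableOn (fun u : ℝ => 2 * σ * u ^ (μ - 2)) (Set.Ioi (2 * |t| + 1)) :=
      (integrableOn_Ioi_rpow_of_lt (by linarith) hR).const_mul _
    refine Integrable.mono' h hmeas.aestronglyMeasurable
      ((ae_restrict_iff' measurableSet_Ioi).2 (.of_forall fun u hu => ?_))
    have hu : 2 * |t| + 1 < u := hu
    have hu0 : 0 < u := hR.trans hu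
    have hpow : 0 ≤ u ^ (μ - 2) := rpow_nonneg hu0.le _
    have hpow' : u ^ (μ - 1) = u ^ (μ - 2) * u := by
      rw [← rpow_add_one hu0.ne']
      ring_nf
    have habs : u / 2 ≤ |t - u| := by
      rw [abs_sub_comm]
      linarith [le_abs_self (u - t), le_abs_self t]
    have hden : u / (2 * σ) ≤ |(t - u) / σ| := by
      rw [abs_div, abs_of_pos hσ, ← div_div]
      gcongr
    rw [norm_of_nonneg (by positivity), hpow', div_le_iff₀ (by positivity)]
    calc u ^ (μ - 2) * u = 2 * σ * u ^ (μ - 2) * (u / (2 * σ)) := by field_simp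
      _ ≤ 2 * σ * u ^ (μ - 2) * (1 + |(t - u) / σ|) := by
        gcongr
        linarith

/-- Absolute convergence of the fractional integral, in the lag variable `u = t - s`. -/
lemma integrableOn_rpow_mul_f0_sub {μ σ : ℝ} (hμ0 : 0 < μ) (hμ1 : μ < 1) (hσ : 0 < σ) (t : ℝ) :
    IntegrableOn (fun u : ℝ => ((u ^ (μ - 1) : ℝ) : ℂ) * f0 σ (t - u)) (Set.Ioi 0) := by
  obtain ⟨C, hC⟩ := exists_norm_gaussianHalfFourier_le
  have hcont := (continuous_f0 hσ).comp (continuous_const.sub continuous_id : Continuous (t - ·))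
  refine Integrable.mono'
    ((integrableOn_rpow_div_one_add_abs hμ0 hμ1 hσ t).const_mul (√(2 / π) * C))
    (AEStronglyMeasurable.mul (by fun_prop) hcont.aestronglyMeasurable)
    ((ae_restrict_iff' measurableSet_Ioi).2 (.of_forall fun u hu => ?_))
  have hu : (0 : ℝ) < u := hu
  rw [norm_mul, f0_eq_gaussianHalfFourier hσ, norm_mul, Complex.norm_real, Complex.norm_real,
    norm_of_nonneg (rpow_nonneg hu.le _), norm_of_nonneg (Real.sqrt_nonneg _)]
  calc u ^ (μ - 1) * (√(2 / π) * ‖gaussianHalfFourier ((t - u) / σ)‖)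
      ≤ u ^ (μ - 1) * (√(2 / π) * (C / (1 + |(t - u) / σ|))) := by
        gcongr
        exact hC _
    _ = √(2 / π) * C * (u ^ (μ - 1) / (1 + |(t - u) / σ|)) := by ring

/-- The fractional integral with the convergence factor `e^(-εu)`, computed by Fubini. -/
lemma integral_exp_neg_mul_rpow_mul_f0_sub {μ σ ε : ℝ} (hμ0 : 0 < μ) (hσ : 0 < σ) (hε : 0 < ε)
    (t : ℝ) :
    ∫ u in Set.Ioi (0:ℝ),
        Complex.exp (-(ε * u)) * (((u ^ (μ - 1) : ℝ) : ℂ) * f0 σ (t - u)) =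
      (√(2 / π) : ℝ) * (Real.Gamma μ : ℂ) * ∫ ω in Set.Ioi (0:ℝ),
        ((Real.exp (-ω ^ 2 / 2) : ℝ) : ℂ) * Complex.exp (Complex.I * (ω * (t / σ : ℝ))) *
          (1 / (ε + Complex.I * (ω / σ))) ^ (μ : ℂ) := by
  set F : ℝ → ℝ → ℂ := fun u ω =>
    ((Real.exp (-ω ^ 2 / 2) : ℝ) : ℂ) * Complex.exp (Complex.I * (ω * (t / σ : ℝ))) *
      (((u ^ (μ - 1) : ℝ) : ℂ) * Complex.exp (-((ε + Complex.I * (ω / σ)) * u))) with hF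
  have hre : ∀ ω : ℝ, (ε + Complex.I * (ω / σ) : ℂ).re = ε := fun ω => by
    rw [← Complex.ofReal_div]
    simp
  have hInt : Integrable (Function.uncurry F)
      ((volume.restrict (Set.Ioi 0)).prod (volume.restrict (Set.Ioi 0))) := by
    have h1 := integrableOn_rpow_mul_cexp_neg_mul hμ0 (z := ε) (by simpa)
    have h2 := (integrable_exp_neg_sq_div_two_mul_cexp (t / σ)).integrableOn (s := Set.Ioi 0)
    refine (Integrable.mul_prod h1 h2).mono (by simp only [hF, Function.uncurry_def]; fun_prop)
      (.of_forall fun p => le_of_eq ?_)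
    have hexp : ‖Complex.exp (-((ε + Complex.I * (p.2 / σ)) * p.1))‖ =
        ‖Complex.exp (-((ε : ℂ) * p.1))‖ := by
      rw [Complex.norm_exp, Complex.norm_exp, Complex.neg_re, Complex.neg_re,
        Complex.re_mul_ofReal, Complex.re_mul_ofReal, hre, Complex.ofReal_re]
    simp only [hF, Function.uncurry_def]
    rw [norm_mul, norm_mul (_ : ℂ) (Complex.exp (-_)), hexp, ← norm_mul (_ : ℂ) (Complex.exp (-_)),
      norm_mul (_ * Complex.exp (-_)), mul_comm]
  have hinner : ∀ u : ℝ,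
      Complex.exp (-(ε * u)) * (((u ^ (μ - 1) : ℝ) : ℂ) * f0 σ (t - u)) =
        (√(2 / π) : ℝ) * ∫ ω in Set.Ioi (0:ℝ), F u ω := by
    intro u
    have : ∫ ω in Set.Ioi (0:ℝ), F u ω =
        Complex.exp (-(ε * u)) * ((u ^ (μ - 1) : ℝ) : ℂ) * gaussianHalfFourier ((t - u) / σ) := by
      rw [gaussianHalfFourier, ← integral_const_mul]
      refine integral_congr_ae (.of_forall fun ω => ?_)
      have hsplit : Complex.exp (Complex.I * (ω * ((t - u) / σ : ℝ))) * Complex.exp (-(ε * u)) =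
          Complex.exp (Complex.I * (ω * (t / σ : ℝ))) *
            Complex.exp (-((ε + Complex.I * (ω / σ)) * u)) := by
        rw [← Complex.exp_add, ← Complex.exp_add]
        push_cast
        ring_nf
      simp only [hF]
      linear_combination (-((Real.exp (-ω ^ 2 / 2) : ℝ) : ℂ) * ((u ^ (μ - 1) : ℝ) : ℂ)) * hsplit
    rw [this, f0_eq_gaussianHalfFourier hσ]
    ring
  simp_rw [hinner]
  rw [integral_const_mul, integral_integral_swap hInt, mul_assoc]
  congr 1
  rw [← integral_const_mul]
  refine integral_congr_ae (.of_forall fun ω => ?_)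
  simp only [hF]
  rw [integral_const_mul, integral_rpow_mul_cexp_neg_mul hμ0 (by rwa [hre])]
  ring

lemma one_div_I_mul_cpow {x : ℝ} (hx : 0 < x) (μ : ℝ) :
    (1 / (Complex.I * x)) ^ (μ : ℂ) =
      ((x ^ (-μ) : ℝ) : ℂ) * Complex.exp (-(Complex.I * (μ * π / 2))) := by
  have h : 1 / (Complex.I * x) = ((x⁻¹ : ℝ) : ℂ) * (-Complex.I) := by
    rw [one_div, mul_inv, Complex.inv_I]
    push_cast
    ring
  have hI : -Complex.I ≠ 0 := neg_ne_zero.2 Complex.I_ne_zero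
  have hx' : ((x⁻¹ : ℝ) : ℂ) ≠ 0 := by exact_mod_cast (inv_pos.2 hx).ne'
  rw [h, Complex.cpow_def_of_ne_zero (mul_ne_zero hx' hI),
    Complex.log_ofReal_mul (inv_pos.2 hx) hI, Complex.log_neg_I, Real.log_inv,
    Real.rpow_def_of_pos hx, Complex.ofReal_exp, ← Complex.exp_add]
  push_cast
  ring_nf

lemma norm_one_div_add_I_mul_cpow_le {μ x ε : ℝ} (hμ : 0 ≤ μ) (hx : 0 < x) :
    ‖(1 / (ε + Complex.I * x)) ^ (μ : ℂ)‖ ≤ x ^ (-μ) := by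
  have h : x ≤ ‖(ε + Complex.I * x : ℂ)‖ := by
    refine (le_abs_self x).trans (le_trans (le_of_eq ?_) (Complex.abs_im_le_norm _))
    simp
  rw [Complex.norm_cpow_real, norm_div, norm_one, one_div, Real.rpow_neg hx.le,
    ← Real.inv_rpow hx.le]
  exact Real.rpow_le_rpow (by positivity) (inv_anti₀ hx h) hμ

lemma tendsto_integral_exp_neg_mul {K : ℝ → ℂ} (hK : IntegrableOn K (Set.Ioi 0)) :
    Filter.Tendsto (fun ε : ℝ => ∫ u in Set.Ioi (0:ℝ), Complex.exp (-(ε * u)) * K u)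
      (nhdsWithin 0 (Set.Ioi 0)) (nhds (∫ u in Set.Ioi (0:ℝ), K u)) := by
  refine tendsto_integral_filter_of_dominated_convergence (fun u => ‖K u‖)
    (.of_forall fun ε => AEStronglyMeasurable.mul (by fun_prop) hK.aestronglyMeasurable) ?_
    hK.norm (.of_forall fun u => ?_)
  · filter_upwards [self_mem_nhdsWithin] with ε hε
    refine (ae_restrict_iff' measurableSet_Ioi).2 (.of_forall fun u hu => ?_)
    have hε : (0 : ℝ) < ε := hε
    have hu : (0 : ℝ) < u := hu
    rw [norm_mul, Complex.norm_exp]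
    refine mul_le_of_le_one_left (norm_nonneg _) (Real.exp_le_one_iff.2 ?_)
    simpa using mul_nonneg hε.le hu.le
  · have : Continuous fun ε : ℝ => Complex.exp (-(ε * u)) * K u := by fun_prop
    exact (this.tendsto' 0 (K u) (by simp)).mono_left nhdsWithin_le_nhds

lemma integrableOn_exp_neg_sq_div_two_mul_rpow {μ σ : ℝ} (hμ1 : μ < 1) (hσ : 0 < σ) :
    IntegrableOn (fun ω : ℝ => Real.exp (-ω ^ 2 / 2) * (ω / σ) ^ (-μ)) (Set.Ioi 0) := by
  refine IntegrableOn.congr_fun ((integrableOn_rpow_mul_exp_neg_mul_sq (b := 1 / 2) (s := -μ)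
    (by norm_num) (by linarith)).div_const (σ ^ (-μ))) (fun ω hω => ?_) measurableSet_Ioi
  have hω : (0 : ℝ) < ω := hω
  rw [Real.div_rpow hω.le hσ.le]
  ring_nf

lemma tendsto_integral_one_div_cpow {μ σ : ℝ} (hμ0 : 0 < μ) (hμ1 : μ < 1) (hσ : 0 < σ) (t : ℝ) :
    Filter.Tendsto (fun ε : ℝ => ∫ ω in Set.Ioi (0:ℝ),
        ((Real.exp (-ω ^ 2 / 2) : ℝ) : ℂ) * Complex.exp (Complex.I * (ω * (t / σ : ℝ))) *
          (1 / (ε + Complex.I * (ω / σ))) ^ (μ : ℂ))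
      (nhdsWithin 0 (Set.Ioi 0))
      (nhds (∫ ω in Set.Ioi (0:ℝ), ((Real.exp (-ω ^ 2 / 2) * (ω / σ) ^ (-μ) : ℝ) : ℂ) *
        Complex.exp (Complex.I * (ω * t / σ - μ * Real.pi / 2)))) := by
  refine tendsto_integral_filter_of_dominated_convergence _
    (.of_forall fun ε => by fun_prop) (.of_forall fun ε => ?_)
    (integrableOn_exp_neg_sq_div_two_mul_rpow hμ1 hσ) ?_
  · refine (ae_restrict_iff' measurableSet_Ioi).2 (.of_forall fun ω hω => ?_)
    rw [norm_mul, norm_exp_neg_sq_div_two_mul_cexp, ← Complex.ofReal_div]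
    gcongr
    exact norm_one_div_add_I_mul_cpow_le hμ0.le (div_pos hω hσ)
  · refine (ae_restrict_iff' measurableSet_Ioi).2 (.of_forall fun ω hω => ?_)
    have hx : 0 < ω / σ := div_pos hω hσ
    have hval : ((Real.exp (-ω ^ 2 / 2) * (ω / σ) ^ (-μ) : ℝ) : ℂ) *
        Complex.exp (Complex.I * (ω * t / σ - μ * Real.pi / 2)) =
        ((Real.exp (-ω ^ 2 / 2) : ℝ) : ℂ) * Complex.exp (Complex.I * (ω * (t / σ : ℝ))) *
          (1 / ((0 : ℝ) + Complex.I * (ω / σ))) ^ (μ : ℂ) := by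
      have hexp : Complex.exp (Complex.I * (ω * t / σ - μ * Real.pi / 2)) =
          Complex.exp (Complex.I * (ω * (t / σ : ℝ))) *
            Complex.exp (-(Complex.I * (μ * π / 2))) := by
        rw [← Complex.exp_add]
        push_cast
        ring_nf
      rw [Complex.ofReal_zero, zero_add, ← Complex.ofReal_div, one_div_I_mul_cpow hx, hexp,
        Complex.ofReal_mul]
      ring
    rw [hval]
    refine Filter.Tendsto.mono_left ?_ nhdsWithin_le_nhds
    have him : (((0 : ℝ) : ℂ) + Complex.I * (ω / σ)).im ≠ 0 := by
      rw [← Complex.ofReal_div]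
      simpa using hx.ne'
    have hne : ((0 : ℝ) : ℂ) + Complex.I * (ω / σ) ≠ 0 :=
      fun h => him (by rw [h, Complex.zero_im])
    have hslit : 1 / (((0 : ℝ) : ℂ) + Complex.I * (ω / σ)) ∈ Complex.slitPlane := by
      refine Or.inr ?_
      rw [one_div, Complex.inv_im]
      exact div_ne_zero (neg_ne_zero.2 him) (Complex.normSq_pos.2 hne).ne'
    refine Filter.Tendsto.const_mul _ ?_
    refine (continuousAt_cpow_const hslit).tendsto.comp ?_
    refine Filter.Tendsto.div tendsto_const_nhds ?_ hne
    exact (Complex.continuous_ofReal.add continuous_const).tendsto 0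

/-- The Riemann–Liouville fractional integral of order `μ ∈ (0,1)` based at `-∞` of
`f₀` converges absolutely and has the one-sided Fourier representation
`√(2/π) ∫_0^∞ e^{-ω²/2} (ω/σ)^{-μ} e^{i(ωt/σ - μπ/2)} dω`. -/
theorem fracIntegral_f0 (μ σ : ℝ) (hμ0 : 0 < μ) (hμ1 : μ < 1) (hσ : 0 < σ) (t : ℝ) :
    MeasureTheory.IntegrableOn
      (fun s : ℝ => (((t - s) ^ (μ - 1) : ℝ) : ℂ) * f0 σ s) (Set.Iio t) ∧
    ((1 / Real.Gamma μ : ℝ) : ℂ) *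
        ∫ s in Set.Iio t, (((t - s) ^ (μ - 1) : ℝ) : ℂ) * f0 σ s =
      ((Real.sqrt (2 / Real.pi) : ℝ) : ℂ) *
        ∫ ω in Set.Ioi (0:ℝ),
          ((Real.exp (-ω ^ 2 / 2) * (ω / σ) ^ (-μ) : ℝ) : ℂ) *
            Complex.exp (Complex.I * (ω * t / σ - μ * Real.pi / 2)) := by
  have hmp := Measure.measurePreserving_sub_left (volume : Measure ℝ) t
  have hemb : MeasurableEmbedding fun s : ℝ => t - s := measurableEmbedding_subLeft t
  have hpre : (fun s : ℝ => t - s) ⁻¹' Set.Ioi 0 = Set.Iio t := by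
    ext s
    simp
  have hK := integrableOn_rpow_mul_f0_sub hμ0 hμ1 hσ t
  have hcomp : ((fun u : ℝ => ((u ^ (μ - 1) : ℝ) : ℂ) * f0 σ (t - u)) ∘ fun s => t - s) =
      fun s : ℝ => (((t - s) ^ (μ - 1) : ℝ) : ℂ) * f0 σ s := by
    ext s
    simp
  constructor
  · rw [← hpre, ← hcomp]
    exact (hmp.integrableOn_comp_preimage hemb).2 hK
  · have hsub : ∫ s in Set.Iio t, (((t - s) ^ (μ - 1) : ℝ) : ℂ) * f0 σ s =
        ∫ u in Set.Ioi (0:ℝ), ((u ^ (μ - 1) : ℝ) : ℂ) * f0 σ (t - u) := by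
      rw [← hcomp, ← hpre]
      exact hmp.setIntegral_preimage_emb hemb
        (fun u : ℝ => ((u ^ (μ - 1) : ℝ) : ℂ) * f0 σ (t - u)) _
    have hlim := ((tendsto_integral_one_div_cpow hμ0 hμ1 hσ t).const_mul
      (((√(2 / π) : ℝ) : ℂ) * (Real.Gamma μ : ℂ))).congr' (by
        filter_upwards [self_mem_nhdsWithin] with ε hε
        exact (integral_exp_neg_mul_rpow_mul_f0_sub hμ0 hσ hε t).symm)
    have hΓ : (Real.Gamma μ : ℂ) ≠ 0 := by exact_mod_cast (Real.Gamma_pos_of_pos hμ0).ne'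
    rw [hsub, tendsto_nhds_unique (tendsto_integral_exp_neg_mul hK) hlim, Complex.ofReal_div,
      Complex.ofReal_one, one_div, mul_comm ((√(2 / π) : ℝ) : ℂ), mul_assoc,
      inv_mul_cancel_left₀ hΓ]
end
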